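/- arXiv:1002.4534 — 12 statements merged into one kernel-verified Lean document; each statement's English description precedes it below -/
import Mathlib

section
/- The constants κ, ν and σ are all positive, and t − f(t)/f'(t) < 0 for all t ∈ (0, ν). (In particular, since f' is strictly increasing, f is strictly convex, so 0 = f(0) > f(t) − t f'(t) for all t ∈ (0, R).) -/
open Filter Metric Set Topology

/-- A function with strictly increasing derivative on `[0, R)` vanishing at `0` lies strictly below
the line through the origin with slope its derivative at `t`, at each `t ∈ (0, R)`. -/
theorem lt_mul_of_strictMonoOn_hasDerivWithinAt {R : ℝ} {f f' : ℝ → ℝ}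
    (hfd : ∀ t ∈ Ico 0 R, HasDerivWithinAt f (f' t) (Ico 0 R) t)
    (h0 : f 0 = 0) (hmono : StrictMonoOn f' (Ico 0 R)) {t : ℝ} (ht : t ∈ Ioo 0 R) :
    f t < t * f' t := by
  have hsub : Icc 0 t ⊆ Ico 0 R := fun s hs => ⟨hs.1, hs.2.trans_lt ht.2⟩
  obtain ⟨c, hc, hslope⟩ := exists_hasDerivAt_eq_slope f f' ht.1
    (fun s hs => ((hfd s (hsub hs)).continuousWithinAt).mono hsub)
    (fun s hs => (hfd s (hsub (Ioo_subset_Icc_self hs))).hasDerivAt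
      (Ico_mem_nhds hs.1 (hs.2.trans ht.2)))
  have hlt : f' c < f' t := hmono (hsub (Ioo_subset_Icc_self hc)) ⟨ht.1.le, ht.2⟩ hc.2
  rwa [hslope, h0, sub_zero, sub_zero, div_lt_iff₀' ht.1] at hlt

/-- A function continuous on `[0, R)` and negative at `0` is negative at some point of `(0, R)`. -/
theorem exists_mem_Ioo_lt_zero {R : ℝ} (hR : 0 < R) {g : ℝ → ℝ}
    (hg : ContinuousOn g (Ico 0 R)) (h0 : g 0 < 0) : ∃ t ∈ Ioo 0 R, g t < 0 := by
  have hlt : ∀ᶠ t in 𝓝[>] (0 : ℝ), g t < 0 := by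
    have hcont : ContinuousWithinAt g (Ioo 0 R) 0 :=
      (hg 0 ⟨le_rfl, hR⟩).mono Ioo_subset_Ico_self
    rw [← nhdsWithin_Ioo_eq_nhdsGT hR]
    exact hcont.eventually_lt_const h0
  obtain ⟨t, ht, htR⟩ := (hlt.and (Ioo_mem_nhdsGT hR)).exists
  exact ⟨t, htR, ht⟩

theorem stmt0
    {X Y : Type*} [NormedAddCommGroup X] [NormedSpace ℝ X] [CompleteSpace X]
    [NormedAddCommGroup Y] [NormedSpace ℝ Y] [CompleteSpace Y]
    (Ω : Set X) (hΩ : IsOpen Ω)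
    (F : X → Y) (F' : X → X →L[ℝ] Y)
    (hF : ∀ x ∈ Ω, HasFDerivAt F (F' x) x)
    (hF'c : ContinuousOn F' Ω)
    (xs : X) (hxs : xs ∈ Ω) (hFxs : F xs = 0)
    (B : Y →L[ℝ] X)
    (hB1 : B.comp (F' xs) = ContinuousLinearMap.id ℝ X)
    (hB2 : (F' xs).comp B = ContinuousLinearMap.id ℝ Y)
    (R : ℝ) (hR : 0 < R)
    (κ : ℝ) (hκ : κ = sSup {t | t ∈ Ico 0 R ∧ ball xs t ⊆ Ω})
    (f f' : ℝ → ℝ)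
    (hfd : ∀ t ∈ Ico 0 R, HasDerivWithinAt f (f' t) (Ico 0 R) t)
    (hf'c : ContinuousOn f' (Ico 0 R))
    (hMH : ∀ τ ∈ Icc (0:ℝ) 1, ∀ x ∈ ball xs κ,
      ‖B.comp (F' x - F' (xs + τ • (x - xs)))‖ ≤ f' ‖x - xs‖ - f' (τ * ‖x - xs‖))
    (h1 : f 0 = 0) (h1' : f' 0 = -1)
    (h2 : StrictMonoOn f' (Ico 0 R))
    (ν : ℝ) (hν : ν = sSup {t | t ∈ Ico 0 R ∧ f' t < 0})
    (σ : ℝ) (hσ : σ = sSup {t | t ∈ Ioo 0 κ ∧ f t < 0})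
    : 0 < κ ∧ 0 < ν ∧ 0 < σ ∧ ∀ t ∈ Ioo 0 ν, t - f t / f' t < 0 := by
  have hκ_pos : 0 < κ := by
    obtain ⟨ε, hε, hball⟩ := Metric.isOpen_iff.mp hΩ xs hxs
    have hpos : 0 < min ε (R / 2) := lt_min hε (half_pos hR)
    rw [hκ]
    exact hpos.trans_le <| le_csSup ⟨R, fun t ht => ht.1.2.le⟩
      ⟨⟨hpos.le, (min_le_right _ _).trans_lt (half_lt_self hR)⟩,
        (ball_subset_ball (min_le_left _ _)).trans hball⟩
  obtain ⟨δ, hδ, hδ_neg⟩ := exists_mem_Ioo_lt_zero hR hf'c (by rw [h1']; norm_num)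
  refine ⟨hκ_pos, ?_, ?_, fun t ht => ?_⟩
  · rw [hν]
    exact hδ.1.trans_le <| le_csSup ⟨R, fun t ht => ht.1.2.le⟩ ⟨⟨hδ.1.le, hδ.2⟩, hδ_neg⟩
  · have hpos : 0 < min δ (κ / 2) := lt_min hδ.1 (half_pos hκ_pos)
    have hmem : min δ (κ / 2) ∈ Ioo 0 R := ⟨hpos, (min_le_left _ _).trans_lt hδ.2⟩
    have hneg : f' (min δ (κ / 2)) < 0 :=
      (h2.monotoneOn ⟨hpos.le, hmem.2⟩ ⟨hδ.1.le, hδ.2⟩ (min_le_left _ _)).trans_lt hδ_neg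
    rw [hσ]
    exact hpos.trans_le <| le_csSup ⟨κ, fun t ht => ht.1.2.le⟩
      ⟨⟨hpos, (min_le_right _ _).trans_lt (half_lt_self hκ_pos)⟩,
        (lt_mul_of_strictMonoOn_hasDerivWithinAt hfd h1 h2 hmem).trans
          (mul_neg_of_pos_of_neg hpos hneg)⟩
  · have hne : {t | t ∈ Ico 0 R ∧ f' t < 0}.Nonempty := ⟨δ, ⟨hδ.1.le, hδ.2⟩, hδ_neg⟩
    obtain ⟨s, ⟨hs, hs_neg⟩, hts⟩ := exists_lt_of_lt_csSup hne (ht.2.trans_eq hν)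
    have htR : t < R := hts.trans hs.2
    have hneg : f' t < 0 := (h2 ⟨ht.1.le, htR⟩ hs hts).trans hs_neg
    rw [sub_neg, lt_div_iff_of_neg hneg]
    exact lt_mul_of_strictMonoOn_hasDerivWithinAt hfd h1 h2 ⟨ht.1, htR⟩
end

section
/- The constant ρ is positive, and |n_f(t)| < t for all t ∈ (0, ρ). -/
open Filter Metric Set Topology

/-- Mean value form, on a half-open interval, for a function vanishing at `0`. -/
lemma exists_mem_Ioo_eq_mul_deriv {R : ℝ} {f f' : ℝ → ℝ}
    (hfd : ∀ t ∈ Ico 0 R, HasDerivWithinAt f (f' t) (Ico 0 R) t) (h0 : f 0 = 0)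
    {t : ℝ} (ht : t ∈ Ioo 0 R) : ∃ c ∈ Ioo 0 t, f t = t * f' c := by
  have hcont : ContinuousOn f (Icc 0 t) := fun x hx =>
    (hfd x ⟨hx.1, hx.2.trans_lt ht.2⟩).continuousWithinAt.mono
      fun y hy => ⟨hy.1, hy.2.trans_lt ht.2⟩
  obtain ⟨c, hc, hslope⟩ := exists_hasDerivAt_eq_slope f f' ht.1 hcont fun x hx =>
    (hfd x ⟨hx.1.le, hx.2.trans ht.2⟩).hasDerivAt (Ico_mem_nhds hx.1 (hx.2.trans ht.2))
  refine ⟨c, hc, ?_⟩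
  rw [hslope, h0, sub_zero, sub_zero, mul_div_cancel₀ _ ht.1.ne']

theorem stmt2
    (R : ℝ) (hR : 0 < R)
    (f f' : ℝ → ℝ)
    (hfd : ∀ t ∈ Ico 0 R, HasDerivWithinAt f (f' t) (Ico 0 R) t)
    (hf'c : ContinuousOn f' (Ico 0 R))
    (h1 : f 0 = 0) (h1' : f' 0 = -1)
    (h2 : StrictMonoOn f' (Ico 0 R))
    (ν : ℝ) (hν : ν = sSup {t | t ∈ Ico 0 R ∧ f' t < 0})
    (ρ : ℝ) (hρ : ρ = sSup {δ | δ ∈ Ioo 0 ν ∧ ∀ t ∈ Ioo 0 δ, (f t / f' t - t) / t < 1})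
    : 0 < ρ ∧ ∀ t ∈ Ioo 0 ρ, |t - f t / f' t| < t := by
  have h0 : (0 : ℝ) ∈ Ico 0 R := ⟨le_rfl, hR⟩
  obtain ⟨m, hm, hmR, hf'm⟩ : ∃ m > 0, m ≤ R ∧ ∀ t ∈ Ico 0 m, f' t < -1 / 2 := by
    have hev : ∀ᶠ t in 𝓝[Ico 0 R] 0, f' t < -1 / 2 :=
      (hf'c 0 h0).eventually_lt_const (by rw [h1']; norm_num)
    obtain ⟨ε, hε, hball⟩ := Metric.mem_nhdsWithin_iff.1 hev
    refine ⟨min ε R, lt_min hε hR, min_le_right _ _, fun t ht => hball ⟨?_, ht.1, ?_⟩⟩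
    · rw [Metric.mem_ball, Real.dist_eq, sub_zero, abs_of_nonneg ht.1]
      exact ht.2.trans_le (min_le_left _ _)
    · exact ht.2.trans_le (min_le_right _ _)
  have hmν : m / 2 ≤ ν := by
    rw [hν]
    refine le_csSup ⟨R, fun x hx => hx.1.2.le⟩ ⟨⟨by linarith, by linarith⟩, ?_⟩
    linarith [hf'm (m / 2) ⟨by linarith, by linarith⟩]
  have hmem : m / 4 ∈ {δ | δ ∈ Ioo 0 ν ∧ ∀ t ∈ Ioo 0 δ, (f t / f' t - t) / t < 1} := by
    refine ⟨⟨by linarith, by linarith⟩, fun t ht => ?_⟩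
    obtain ⟨ht0, htm⟩ := ht
    obtain ⟨c, hc, hfc⟩ := exists_mem_Ioo_eq_mul_deriv hfd h1 (t := t) ⟨ht0, by linarith⟩
    have hf't := hf'm t ⟨ht0.le, by linarith⟩
    have hf'c := h2 h0 ⟨hc.1.le, by linarith [hc.2]⟩ hc.1
    have hquot : f t / f' t < 2 * t := by
      rw [div_lt_iff_of_neg (by linarith), hfc]
      nlinarith
    rw [div_lt_one ht0]
    linarith
  have hρpos : 0 < ρ := by
    rw [hρ]
    exact (show 0 < m / 4 by linarith).trans_le (le_csSup ⟨ν, fun x hx => hx.1.2.le⟩ hmem)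
  refine ⟨hρpos, fun t ht => ?_⟩
  obtain ⟨ht0, htρ⟩ := ht
  rw [hρ] at htρ
  obtain ⟨δ, ⟨hδ, hlt⟩, htδ⟩ := exists_lt_of_lt_csSup ⟨_, hmem⟩ htρ
  have htν := htδ.trans hδ.2
  rw [hν] at htν
  have hne : {t | t ∈ Ico 0 R ∧ f' t < 0}.Nonempty := ⟨0, h0, by rw [h1']; norm_num⟩
  obtain ⟨s, ⟨hsR, hs⟩, hts⟩ := exists_lt_of_lt_csSup hne htν
  have htR : t < R := hts.trans hsR.2
  have hf't : f' t < 0 := (h2 ⟨ht0.le, htR⟩ hsR hts).trans hs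
  obtain ⟨c, hc, hfc⟩ := exists_mem_Ioo_eq_mul_deriv hfd h1 ⟨ht0, htR⟩
  have hct := h2 ⟨hc.1.le, hc.2.trans htR⟩ ⟨ht0.le, htR⟩ hc.2
  have hquot : t < f t / f' t := by
    rw [lt_div_iff_of_neg hf't, hfc]
    exact mul_lt_mul_of_pos_left hct ht0
  have hbound := (div_lt_one ht0).1 (hlt t ⟨ht0, htδ⟩)
  rw [abs_of_neg (by linarith)]
  linarith
end

section
/- For any t₀ ∈ (0, ρ), the sequence defined by t_{k+1} = |n_f(t_k)| is well defined, strictly decreasing, contained in (0, ρ), and converges to 0 with superlinear rate, i.e. lim_{k→∞} t_{k+1}/t_k = 0. -/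
open Filter Metric Set Topology

/-- The tangent line of a function with strictly increasing derivative lies strictly below it. -/
theorem sub_lt_mul_deriv_of_strictMonoOn {R : ℝ} {f f' : ℝ → ℝ}
    (hfd : ∀ t ∈ Ico 0 R, HasDerivWithinAt f (f' t) (Ico 0 R) t)
    (hmono : StrictMonoOn f' (Ico 0 R)) {t : ℝ} (ht : 0 < t) (htR : t < R) :
    f t - f 0 < t * f' t := by
  have hsub : Icc 0 t ⊆ Ico 0 R := fun x hx => ⟨hx.1, hx.2.trans_lt htR⟩
  obtain ⟨c, hc, hslope⟩ := exists_hasDerivAt_eq_slope f f' ht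
    (fun x hx => ((hfd x (hsub hx)).continuousWithinAt).mono hsub)
    (fun x hx => (hfd x (hsub (Ioo_subset_Icc_self hx))).hasDerivAt
      (Ico_mem_nhds hx.1 (hx.2.trans htR)))
  have hlt : f' c < f' t :=
    hmono (hsub (Ioo_subset_Icc_self hc)) (hsub ⟨ht.le, le_rfl⟩) hc.2
  rw [hslope, sub_zero, div_lt_iff₀ ht] at hlt
  linarith

/-- The relative Newton step towards a simple zero at `0` vanishes at `0`. -/
theorem tendsto_newton_div_self {R : ℝ} (hR : 0 < R) {f f' : ℝ → ℝ}
    (hf : HasDerivWithinAt f (f' 0) (Ico 0 R) 0) (hf' : ContinuousWithinAt f' (Ico 0 R) 0)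
    (h0 : f 0 = 0) (h0' : f' 0 ≠ 0) :
    Tendsto (fun t => (t - f t / f' t) / t) (𝓝[>] 0) (𝓝 0) := by
  have hle : 𝓝[>] (0 : ℝ) ≤ 𝓝[Ico 0 R] 0 := by
    rw [← nhdsWithin_Ioo_eq_nhdsGT hR]
    exact nhdsWithin_mono _ Ioo_subset_Ico_self
  have hslope : Tendsto (fun t => f t / t) (𝓝[>] 0) (𝓝 (f' 0)) := by
    have h := hasDerivWithinAt_iff_tendsto_slope.1 hf
    have hle' : 𝓝[>] (0 : ℝ) ≤ 𝓝[Ico 0 R \ {0}] 0 := by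
      rw [← nhdsWithin_Ioo_eq_nhdsGT hR]
      exact nhdsWithin_mono _ fun x hx => ⟨Ioo_subset_Ico_self hx, hx.1.ne'⟩
    refine (h.mono_left hle').congr fun t => ?_
    simp [slope_def_field, h0]
  have hlim := (hslope.div (hf'.mono_left hle) h0').const_sub 1
  rw [div_self h0', sub_self] at hlim
  refine hlim.congr' ?_
  filter_upwards [self_mem_nhdsWithin] with t ht
  have ht0 : t ≠ 0 := (mem_Ioi.1 ht).ne'
  rw [Pi.div_apply, sub_div, div_self ht0, div_right_comm]

/-- Iterates of a continuous self-map of `(0, ρ)` that lies strictly below the identity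
decrease to `0`. -/
theorem strictAnti_and_tendsto_zero_of_lt_self {ρ : ℝ} {g : ℝ → ℝ}
    (hpos : ∀ x ∈ Ioo 0 ρ, 0 < g x) (hlt : ∀ x ∈ Ioo 0 ρ, g x < x)
    (hcont : ∀ x ∈ Ioo 0 ρ, ContinuousAt g x) {t : ℕ → ℝ} (h0 : t 0 ∈ Ioo 0 ρ)
    (hrec : ∀ k, t (k + 1) = g (t k)) :
    StrictAnti t ∧ (∀ k, t k ∈ Ioo 0 ρ) ∧ Tendsto t atTop (𝓝 0) := by
  have hmem : ∀ k, t k ∈ Ioo 0 ρ := by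
    intro k
    induction k with
    | zero => exact h0
    | succ k ih =>
      rw [hrec]
      exact ⟨hpos _ ih, (hlt _ ih).trans ih.2⟩
  have hanti : StrictAnti t := strictAnti_nat_of_succ_lt fun k => by
    rw [hrec]
    exact hlt _ (hmem k)
  have hbdd : BddBelow (range t) := ⟨0, forall_mem_range.2 fun k => (hmem k).1.le⟩
  have hlim := tendsto_atTop_ciInf hanti.antitone hbdd
  set L := ⨅ k, t k
  have hL0 : 0 ≤ L := le_ciInf fun k => (hmem k).1.le
  rcases hL0.eq_or_lt with hL | hL
  · exact ⟨hanti, hmem, hL ▸ hlim⟩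
  · have hL' : L ∈ Ioo 0 ρ := ⟨hL, (ciInf_le hbdd 0).trans_lt h0.2⟩
    have hstep : Tendsto (fun k => t (k + 1)) atTop (𝓝 (g L)) :=
      ((hcont L hL').tendsto.comp hlim).congr fun k => (hrec k).symm
    have heq := tendsto_nhds_unique hstep (hlim.comp (tendsto_add_atTop_nat 1))
    exact absurd heq (hlt L hL').ne

theorem stmt3
    (R : ℝ) (hR : 0 < R)
    (f f' : ℝ → ℝ)
    (hfd : ∀ t ∈ Ico 0 R, HasDerivWithinAt f (f' t) (Ico 0 R) t)
    (hf'c : ContinuousOn f' (Ico 0 R))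
    (h1 : f 0 = 0) (h1' : f' 0 = -1)
    (h2 : StrictMonoOn f' (Ico 0 R))
    (ν : ℝ) (hν : ν = sSup {t | t ∈ Ico 0 R ∧ f' t < 0})
    (ρ : ℝ) (hρ : ρ = sSup {δ | δ ∈ Ioo 0 ν ∧ ∀ t ∈ Ioo 0 δ, (f t / f' t - t) / t < 1})
    : ∀ t₀ ∈ Ioo 0 ρ, ∀ t : ℕ → ℝ, t 0 = t₀ →
      (∀ k, t (k+1) = |t k - f (t k) / f' (t k)|) →
      StrictAnti t ∧ (∀ k, t k ∈ Ioo 0 ρ) ∧ Tendsto t atTop (𝓝 0) ∧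
      Tendsto (fun k => t (k+1) / t k) atTop (𝓝 0) := by
  have hρmem : ∀ x ∈ Ioo 0 ρ, x < R ∧ f' x < 0 ∧ (f x / f' x - x) / x < 1 := by
    intro x hx
    have hne : {δ | δ ∈ Ioo 0 ν ∧ ∀ t ∈ Ioo 0 δ, (f t / f' t - t) / t < 1}.Nonempty := by
      by_contra h
      rw [not_nonempty_iff_eq_empty] at h
      rw [h, Real.sSup_empty] at hρ
      linarith [hx.1, hx.2]
    obtain ⟨δ, ⟨hδν, hδ⟩, hxδ⟩ := exists_lt_of_lt_csSup hne (hρ ▸ hx.2)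
    have hzero : (0 : ℝ) ∈ {t | t ∈ Ico 0 R ∧ f' t < 0} := ⟨⟨le_rfl, hR⟩, by rw [h1']; norm_num⟩
    obtain ⟨s, ⟨hsR, hs⟩, hxs⟩ := exists_lt_of_lt_csSup ⟨0, hzero⟩ (hν ▸ hxδ.trans hδν.2)
    have hxR := hxs.trans hsR.2
    exact ⟨hxR, (h2 ⟨hx.1.le, hxR⟩ hsR hxs).trans hs, hδ x ⟨hx.1, hxδ⟩⟩
  have hneg : ∀ x ∈ Ioo 0 ρ, x - f x / f' x < 0 := by
    intro x hx
    obtain ⟨hxR, hx', -⟩ := hρmem x hx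
    have h := sub_lt_mul_deriv_of_strictMonoOn hfd h2 hx.1 hxR
    rw [h1, sub_zero] at h
    rw [sub_neg, lt_div_iff_of_neg hx']
    exact h
  intro t₀ ht₀ t ht0 hrec
  obtain ⟨hanti, hmem, hlim⟩ := strictAnti_and_tendsto_zero_of_lt_self
    (g := fun x => |x - f x / f' x|) (ρ := ρ)
    (fun x hx => abs_pos.2 (hneg x hx).ne)
    (fun x hx => by
      have h := (hρmem x hx).2.2
      rw [div_lt_one hx.1] at h
      rw [abs_of_neg (hneg x hx)]
      linarith)
    (fun x hx => by
      obtain ⟨hxR, hx', -⟩ := hρmem x hx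
      have hnhds := Ico_mem_nhds hx.1 hxR
      have hfx := ((hfd x ⟨hx.1.le, hxR⟩).hasDerivAt hnhds).continuousAt
      exact (continuousAt_id.sub (hfx.div (hf'c.continuousAt hnhds) hx'.ne)).abs)
    (ht0 ▸ ht₀) hrec
  refine ⟨hanti, hmem, hlim, ?_⟩
  have hright : Tendsto t atTop (𝓝[>] 0) :=
    tendsto_nhdsWithin_iff.2 ⟨hlim, Eventually.of_forall fun k => (hmem k).1⟩
  have hratio := ((tendsto_newton_div_self hR (hfd 0 ⟨le_rfl, hR⟩) (hf'c 0 ⟨le_rfl, hR⟩) h1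
    (by rw [h1']; norm_num)).comp hright).abs
  rw [abs_zero] at hratio
  refine hratio.congr fun k => ?_
  rw [hrec, Function.comp_apply, abs_div, abs_of_pos (hmem k).1]
end

section
/- If, for a given p with 0 ≤ p ≤ 1, the function t ↦ (f(t)/f'(t) − t)/t^{p+1} is strictly increasing on (0, ν), then for any t₀ ∈ (0, ρ) the sequence t_{k+1} = |n_f(t_k)| has the property that the sequence {t_{k+1}/t_k^{p+1}} is strictly decreasing. -/
open Filter Metric Set Topology

/-- For a function with strictly increasing derivative and `f 0 = 0`, the tangent at `t > 0`
lies strictly below the function at `0`. -/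
theorem lt_deriv_mul_of_strictMonoOn {R : ℝ} {f f' : ℝ → ℝ}
    (hfd : ∀ t ∈ Ico 0 R, HasDerivWithinAt f (f' t) (Ico 0 R) t) (hf0 : f 0 = 0)
    (hmono : StrictMonoOn f' (Ico 0 R)) {t : ℝ} (ht : t ∈ Ioo 0 R) : f t < f' t * t := by
  have hsub : Icc 0 t ⊆ Ico 0 R := fun x hx => ⟨hx.1, hx.2.trans_lt ht.2⟩
  obtain ⟨c, hc, hslope⟩ := exists_hasDerivAt_eq_slope f f' ht.1
    (fun x hx => ((hfd x (hsub hx)).continuousWithinAt).mono hsub)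
    (fun x hx => (hfd x (hsub (Ioo_subset_Icc_self hx))).hasDerivAt
      (Ico_mem_nhds hx.1 (hx.2.trans ht.2)))
  have hlt : f' c < f' t := hmono (hsub (Ioo_subset_Icc_self hc)) ⟨ht.1.le, ht.2⟩ hc.2
  rw [hslope, hf0, sub_zero, sub_zero, div_lt_iff₀ ht.1] at hlt
  exact hlt

/-- A nonnegative real strictly below `sSup S` lies strictly below some element of `S`. -/
theorem exists_mem_lt_of_lt_sSup_of_nonneg {S : Set ℝ} {x : ℝ} (hx : 0 ≤ x) (h : x < sSup S) :
    ∃ s ∈ S, x < s := by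
  refine exists_lt_of_lt_csSup (nonempty_iff_ne_empty.2 fun hS => ?_) h
  rw [hS, Real.sSup_empty] at h
  exact absurd h hx.not_gt

theorem stmt4
    (R : ℝ) (hR : 0 < R)
    (f f' : ℝ → ℝ)
    (hfd : ∀ t ∈ Ico 0 R, HasDerivWithinAt f (f' t) (Ico 0 R) t)
    (hf'c : ContinuousOn f' (Ico 0 R))
    (h1 : f 0 = 0) (h1' : f' 0 = -1)
    (h2 : StrictMonoOn f' (Ico 0 R))
    (ν : ℝ) (hν : ν = sSup {t | t ∈ Ico 0 R ∧ f' t < 0})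
    (ρ : ℝ) (hρ : ρ = sSup {δ | δ ∈ Ioo 0 ν ∧ ∀ t ∈ Ioo 0 δ, (f t / f' t - t) / t < 1})
    (p : ℝ) (hp0 : 0 ≤ p) (hp1 : p ≤ 1)
    (h3 : StrictMonoOn (fun t : ℝ => (f t / f' t - t) / t ^ (p+1)) (Ioo 0 ν))
    : ∀ t₀ ∈ Ioo 0 ρ, ∀ t : ℕ → ℝ, t 0 = t₀ →
      (∀ k, t (k+1) = |t k - f (t k) / f' (t k)|) →
      StrictAnti (fun k => t (k+1) / t k ^ (p+1)) := by
  intro t₀ ht₀ t ht0 hrec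
  have hpos : ∀ x ∈ Ioo 0 ν, 0 < f x / f' x - x := by
    intro x hx
    obtain ⟨s, ⟨hs, hs'⟩, hxs⟩ := exists_mem_lt_of_lt_sSup_of_nonneg hx.1.le (hν ▸ hx.2)
    have hxR : x < R := hxs.trans hs.2
    have hneg : f' x < 0 := (h2 ⟨hx.1.le, hxR⟩ hs hxs).trans hs'
    rw [sub_pos, lt_div_iff_of_neg hneg, mul_comm]
    exact lt_deriv_mul_of_strictMonoOn hfd h1 h2 ⟨hx.1, hxR⟩
  have hbelow : ∀ x ∈ Ioo 0 ρ, x < ν ∧ f x / f' x - x < x := by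
    intro x hx
    obtain ⟨δ, ⟨hδ, hδ'⟩, hxδ⟩ := exists_mem_lt_of_lt_sSup_of_nonneg hx.1.le (hρ ▸ hx.2)
    exact ⟨hxδ.trans hδ.2, (div_lt_one hx.1).1 (hδ' x ⟨hx.1, hxδ⟩)⟩
  have hstep : ∀ k, t k ∈ Ioo 0 ρ → t (k + 1) = f (t k) / f' (t k) - t k := by
    intro k hk
    rw [hrec, abs_sub_comm, abs_of_pos (hpos _ ⟨hk.1, (hbelow _ hk).1⟩)]
  have hmem : ∀ k, t k ∈ Ioo 0 ρ := by
    intro k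
    induction k with
    | zero => rwa [ht0]
    | succ k ih =>
      rw [hstep k ih]
      exact ⟨hpos _ ⟨ih.1, (hbelow _ ih).1⟩, (hbelow _ ih).2.trans ih.2⟩
  have hν_mem : ∀ k, t k ∈ Ioo 0 ν := fun k => ⟨(hmem k).1, (hbelow _ (hmem k)).1⟩
  refine strictAnti_nat_of_succ_lt fun k => ?_
  have hlt : t (k + 1) < t k := by
    rw [hstep k (hmem k)]
    exact (hbelow _ (hmem k)).2
  have hquot := h3 (hν_mem (k + 1)) (hν_mem k) hlt
  simp only [← hstep _ (hmem _)] at hquot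
  exact hquot
end

section
/- If ‖x − x*‖ < min{κ, ν}, then the Fréchet derivative F'(x) is invertible and ‖F'(x)^{-1} F'(x*)‖ ≤ 1/|f'(‖x − x*‖)|. -/
open Filter Metric Set Topology

/-- An operator within distance `q < 1` of the identity is invertible, and its
inverse has norm at most `1 / (1 - q)`. -/
theorem exists_inverse_of_norm_id_sub_le {X : Type*} [NormedAddCommGroup X] [NormedSpace ℝ X]
    [CompleteSpace X] (A : X →L[ℝ] X) {q : ℝ} (hq : q < 1)
    (hA : ‖ContinuousLinearMap.id ℝ X - A‖ ≤ q) :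
    ∃ J : X →L[ℝ] X, J.comp A = ContinuousLinearMap.id ℝ X ∧
      A.comp J = ContinuousLinearMap.id ℝ X ∧ ‖J‖ ≤ 1 / (1 - q) := by
  let u : (X →L[ℝ] X)ˣ := Units.oneSub (ContinuousLinearMap.id ℝ X - A) (hA.trans_lt hq)
  have hu : (u : X →L[ℝ] X) = A := sub_sub_cancel (ContinuousLinearMap.id ℝ X) A
  have hAJ : A.comp (↑u⁻¹ : X →L[ℝ] X) = ContinuousLinearMap.id ℝ X := by
    rw [← hu]; exact u.mul_inv
  refine ⟨↑u⁻¹, by rw [← hu]; exact u.inv_mul, hAJ, ?_⟩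
  have hpos : 0 < 1 - q := sub_pos.mpr hq
  refine ContinuousLinearMap.opNorm_le_bound _ (by positivity) fun v => ?_
  set w : X := (↑u⁻¹ : X →L[ℝ] X) v with hw
  have hAw : A w = v := DFunLike.congr_fun hAJ v
  have hdiff : ‖w - v‖ ≤ q * ‖w‖ := by
    have := (ContinuousLinearMap.id ℝ X - A).le_of_opNorm_le hA w
    simpa [hAw] using this
  have htri : ‖w‖ - ‖v‖ ≤ ‖w - v‖ := norm_sub_norm_le w v
  rw [one_div_mul_eq_div, le_div_iff₀ hpos]
  linarith

theorem stmt5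
    {X Y : Type*} [NormedAddCommGroup X] [NormedSpace ℝ X] [CompleteSpace X]
    [NormedAddCommGroup Y] [NormedSpace ℝ Y] [CompleteSpace Y]
    (Ω : Set X) (hΩ : IsOpen Ω)
    (F : X → Y) (F' : X → X →L[ℝ] Y)
    (hF : ∀ x ∈ Ω, HasFDerivAt F (F' x) x)
    (hF'c : ContinuousOn F' Ω)
    (xs : X) (hxs : xs ∈ Ω) (hFxs : F xs = 0)
    (B : Y →L[ℝ] X)
    (hB1 : B.comp (F' xs) = ContinuousLinearMap.id ℝ X)
    (hB2 : (F' xs).comp B = ContinuousLinearMap.id ℝ Y)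
    (R : ℝ) (hR : 0 < R)
    (κ : ℝ) (hκ : κ = sSup {t | t ∈ Ico 0 R ∧ ball xs t ⊆ Ω})
    (f f' : ℝ → ℝ)
    (hfd : ∀ t ∈ Ico 0 R, HasDerivWithinAt f (f' t) (Ico 0 R) t)
    (hf'c : ContinuousOn f' (Ico 0 R))
    (hMH : ∀ τ ∈ Icc (0:ℝ) 1, ∀ x ∈ ball xs κ,
      ‖B.comp (F' x - F' (xs + τ • (x - xs)))‖ ≤ f' ‖x - xs‖ - f' (τ * ‖x - xs‖))
    (h1 : f 0 = 0) (h1' : f' 0 = -1)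
    (h2 : StrictMonoOn f' (Ico 0 R))
    (ν : ℝ) (hν : ν = sSup {t | t ∈ Ico 0 R ∧ f' t < 0})
    : ∀ x : X, ‖x - xs‖ < min κ ν →
      ∃ G : Y →L[ℝ] X, G.comp (F' x) = ContinuousLinearMap.id ℝ X ∧
        (F' x).comp G = ContinuousLinearMap.id ℝ Y ∧
        ‖G.comp (F' xs)‖ ≤ 1 / |f' ‖x - xs‖| := by
  intro x hx
  obtain ⟨hxκ, hxν⟩ := lt_min_iff.mp hx
  have hne : {t | t ∈ Ico 0 R ∧ f' t < 0}.Nonempty :=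
    ⟨0, ⟨le_rfl, hR⟩, by rw [h1']; norm_num⟩
  rw [hν] at hxν
  obtain ⟨s, ⟨hs, hfs⟩, hts⟩ := exists_lt_of_lt_csSup hne hxν
  have hneg : f' ‖x - xs‖ < 0 :=
    (h2 ⟨norm_nonneg _, hts.trans hs.2⟩ hs hts).trans hfs
  have hq := hMH 0 ⟨le_rfl, zero_le_one⟩ x (by rwa [mem_ball, dist_eq_norm])
  rw [zero_smul, add_zero, zero_mul, h1', ContinuousLinearMap.comp_sub, hB1] at hq
  have hq' : ‖ContinuousLinearMap.id ℝ X - B.comp (F' x)‖ ≤ f' ‖x - xs‖ + 1 := by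
    rw [norm_sub_rev]; linarith
  obtain ⟨J, hJA, hAJ, hJ⟩ := exists_inverse_of_norm_id_sub_le (B.comp (F' x))
    (by linarith : f' ‖x - xs‖ + 1 < 1) hq'
  have hAF : (F' xs).comp (B.comp (F' x)) = F' x := by
    rw [← ContinuousLinearMap.comp_assoc, hB2, ContinuousLinearMap.id_comp]
  refine ⟨J.comp B, by rw [ContinuousLinearMap.comp_assoc, hJA], ?_, ?_⟩
  · calc (F' x).comp (J.comp B)
        = (F' xs).comp (((B.comp (F' x)).comp J).comp B) := by
          conv_lhs => rw [← hAF]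
          simp only [ContinuousLinearMap.comp_assoc]
      _ = ContinuousLinearMap.id ℝ Y := by
          rw [hAJ, ContinuousLinearMap.id_comp, hB2]
  · rw [ContinuousLinearMap.comp_assoc, hB1, ContinuousLinearMap.comp_id, abs_of_neg hneg]
    convert hJ using 2
    ring
end

section
/- If ‖x − x*‖ < κ, then ‖F'(x*)^{-1} E_F(x, x*)‖ ≤ e_f(‖x − x*‖, 0), where E_F(x,y) := F(y) − [F(x) + F'(x)(y − x)] is the linearization error of F and e_f(t,u) := f(u) − [f(t) + f'(t)(u − t)] is the linearization error of f. -/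
open Filter Metric Set Topology

theorem stmt6
    {X Y : Type*} [NormedAddCommGroup X] [NormedSpace ℝ X] [CompleteSpace X]
    [NormedAddCommGroup Y] [NormedSpace ℝ Y] [CompleteSpace Y]
    (Ω : Set X) (hΩ : IsOpen Ω)
    (F : X → Y) (F' : X → X →L[ℝ] Y)
    (hF : ∀ x ∈ Ω, HasFDerivAt F (F' x) x)
    (hF'c : ContinuousOn F' Ω)
    (xs : X) (hxs : xs ∈ Ω) (hFxs : F xs = 0)
    (B : Y →L[ℝ] X)
    (hB1 : B.comp (F' xs) = ContinuousLinearMap.id ℝ X)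
    (hB2 : (F' xs).comp B = ContinuousLinearMap.id ℝ Y)
    (R : ℝ) (hR : 0 < R)
    (κ : ℝ) (hκ : κ = sSup {t | t ∈ Ico 0 R ∧ ball xs t ⊆ Ω})
    (f f' : ℝ → ℝ)
    (hfd : ∀ t ∈ Ico 0 R, HasDerivWithinAt f (f' t) (Ico 0 R) t)
    (hf'c : ContinuousOn f' (Ico 0 R))
    (hMH : ∀ τ ∈ Icc (0:ℝ) 1, ∀ x ∈ ball xs κ,
      ‖B.comp (F' x - F' (xs + τ • (x - xs)))‖ ≤ f' ‖x - xs‖ - f' (τ * ‖x - xs‖))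
    (h1 : f 0 = 0) (h1' : f' 0 = -1)
    (h2 : StrictMonoOn f' (Ico 0 R))
    : ∀ x : X, ‖x - xs‖ < κ →
      ‖B (F xs - (F x + F' x (xs - x)))‖ ≤
        f 0 - (f ‖x - xs‖ + f' ‖x - xs‖ * (0 - ‖x - xs‖)) := by
  intro x hx
  set v := x - xs with hv
  set s := ‖v‖ with hs
  have hs0 : 0 ≤ s := norm_nonneg v
  obtain ⟨t, ⟨ht, htΩ⟩, hst⟩ : ∃ t ∈ {t | t ∈ Ico 0 R ∧ ball xs t ⊆ Ω}, s < t :=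
    exists_lt_of_lt_csSup ⟨0, ⟨le_rfl, hR⟩, by simp⟩ (hκ ▸ hx)
  have hscale : ∀ τ ∈ Icc (0:ℝ) 1, τ * s ∈ Ico 0 R := fun τ hτ =>
    ⟨mul_nonneg hτ.1 hs0, (mul_le_of_le_one_left hs0 hτ.2).trans_lt (hst.trans ht.2)⟩
  have hseg : ∀ τ ∈ Icc (0:ℝ) 1, xs + τ • v ∈ Ω := fun τ hτ => htΩ <| by
    rw [mem_ball_iff_norm, add_sub_cancel_left, norm_smul, Real.norm_of_nonneg hτ.1]
    exact (mul_le_of_le_one_left hs0 hτ.2).trans_lt hst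
  have hG : ∀ τ ∈ Icc (0:ℝ) 1,
      HasDerivAt (fun τ : ℝ => B (F (xs + τ • v)) - τ • B (F' x v) - B (F xs))
        (B (F' (xs + τ • v) v) - B (F' x v)) τ := fun τ hτ => by
    have hline : HasDerivAt (fun τ : ℝ => xs + τ • v) v τ := by
      simpa using ((hasDerivAt_id τ).smul_const v).const_add xs
    have hBF := B.hasFDerivAt.comp_hasDerivAt τ ((hF _ (hseg τ hτ)).comp_hasDerivAt τ hline)
    have hlin : HasDerivAt (fun τ : ℝ => τ • B (F' x v)) (B (F' x v)) τ := by
      simpa using (hasDerivAt_id τ).smul_const (B (F' x v))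
    exact (hBF.sub hlin).sub_const _
  have hH : ∀ τ ∈ Icc (0:ℝ) 1,
      HasDerivWithinAt (fun τ : ℝ => τ * (f' s * s) - f (τ * s) + f 0)
        (f' s * s - f' (τ * s) * s) (Icc 0 1) τ := fun τ hτ => by
    have hmul : ∀ c : ℝ, HasDerivWithinAt (fun τ : ℝ => τ * c) c (Icc 0 1) τ := fun c => by
      simpa using (hasDerivWithinAt_id τ (Icc (0:ℝ) 1)).mul_const c
    exact ((hmul _).sub ((hfd _ (hscale τ hτ)).comp τ (hmul s) hscale)).add_const _
  have key := image_norm_le_of_norm_deriv_right_le_deriv_boundary'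
    (fun τ hτ => (hG τ hτ).continuousAt.continuousWithinAt)
    (fun τ hτ => (hG τ (Ico_subset_Icc_self hτ)).hasDerivWithinAt)
    (by simp)
    (fun τ hτ => (hH τ hτ).continuousWithinAt)
    (fun τ hτ => (hH τ (Ico_subset_Icc_self hτ)).mono_of_mem_nhdsWithin
      (Icc_mem_nhdsGE_of_mem hτ))
    (fun τ hτ => by
      have hle := (B.comp (F' x - F' (xs + τ • v))).le_of_opNorm_le
        (hMH τ (Ico_subset_Icc_self hτ) x (mem_ball_iff_norm.2 hx)) v
      rw [← sub_mul, ← norm_neg, neg_sub]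
      simpa using hle)
    (right_mem_Icc.2 zero_le_one)
  have hx1 : xs + (1:ℝ) • v = x := by simp [hv]
  have hneg : xs - x = -v := by simp [hv]
  have herr : B (F xs - (F x + F' x (xs - x))) =
      -(B (F (xs + (1:ℝ) • v)) - (1:ℝ) • B (F' x v) - B (F xs)) := by
    rw [hx1, hneg]
    simp only [map_sub, map_add, map_neg, one_smul]
    abel
  rw [herr, norm_neg]
  refine key.trans_eq ?_
  rw [one_mul, one_mul]
  ring
end

section
/- If ‖x − x*‖ < r, then ‖N_F(x) − x*‖ ≤ |n_f(‖x − x*‖)|, where N_F(x) := x − F'(x)^{-1}F(x) is the Newton iteration map of F and n_f(t) := t − f(t)/f'(t). As a consequence, N_F maps the open ball B(x*, r) into itself. -/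
open Filter Metric Set Topology

/-- Majorant bound for the linearization error of Newton's method along the segment from `xs`
to `x`. -/
theorem norm_newton_error_le {X Y Z : Type*} [NormedAddCommGroup X] [NormedSpace ℝ X]
    [NormedAddCommGroup Y] [NormedSpace ℝ Y] [NormedAddCommGroup Z] [NormedSpace ℝ Z]
    {F : X → Y} {F' : X → X →L[ℝ] Y} {xs x : X} (B : Y →L[ℝ] Z) {R : ℝ} {f f' : ℝ → ℝ}
    (hF : ∀ τ ∈ Icc (0 : ℝ) 1, HasFDerivAt F (F' (xs + τ • (x - xs))) (xs + τ • (x - xs)))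
    (hFxs : F xs = 0)
    (hfd : ∀ t ∈ Ico 0 R, HasDerivWithinAt f (f' t) (Ico 0 R) t) (h0 : f 0 = 0)
    (hxR : ‖x - xs‖ < R)
    (hMH : ∀ τ ∈ Icc (0 : ℝ) 1,
      ‖B.comp (F' x - F' (xs + τ • (x - xs)))‖ ≤ f' ‖x - xs‖ - f' (τ * ‖x - xs‖)) :
    ‖B (F' x (x - xs) - F x)‖ ≤ ‖x - xs‖ * f' ‖x - xs‖ - f ‖x - xs‖ := by
  set v := x - xs with hv
  set s := ‖v‖ with hs
  have hs0 : 0 ≤ s := norm_nonneg v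
  have hmaps : MapsTo (fun τ : ℝ => τ * s) (Icc 0 1) (Ico 0 R) := fun τ hτ =>
    ⟨mul_nonneg hτ.1 hs0, (mul_le_of_le_one_left hs0 hτ.2).trans_lt hxR⟩
  have hφ : ∀ τ ∈ Icc (0 : ℝ) 1, HasDerivAt
      (fun τ : ℝ => B (τ • F' x v - F (xs + τ • v))) (B (F' x v - F' (xs + τ • v) v)) τ := by
    intro τ hτ
    have hline : HasDerivAt (fun τ : ℝ => xs + τ • v) v τ := by
      simpa using ((hasDerivAt_id τ).smul_const v).const_add xs
    have hlin : HasDerivAt (fun τ : ℝ => τ • F' x v) (F' x v) τ := by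
      simpa using (hasDerivAt_id τ).smul_const (F' x v)
    exact B.hasFDerivAt.comp_hasDerivAt τ (hlin.sub ((hF τ hτ).comp_hasDerivAt τ hline))
  have hg : ∀ τ ∈ Icc (0 : ℝ) 1, HasDerivWithinAt
      (fun τ : ℝ => τ * (s * f' s) - f (τ * s)) (s * f' s - f' (τ * s) * s) (Icc 0 1) τ := by
    intro τ hτ
    have hmul : HasDerivWithinAt (fun τ : ℝ => τ * s) s (Icc 0 1) τ := by
      simpa using (hasDerivWithinAt_id τ (Icc 0 1)).mul_const s
    have hlin : HasDerivWithinAt (fun τ : ℝ => τ * (s * f' s)) (s * f' s) (Icc 0 1) τ := by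
      simpa using (hasDerivWithinAt_id τ (Icc 0 1)).mul_const (s * f' s)
    exact hlin.sub ((hfd _ (hmaps hτ)).comp τ hmul hmaps)
  have key := image_norm_le_of_norm_deriv_right_le_deriv_boundary'
    (f := fun τ : ℝ => B (τ • F' x v - F (xs + τ • v)))
    (f' := fun τ : ℝ => B (F' x v - F' (xs + τ • v) v))
    (B := fun τ : ℝ => τ * (s * f' s) - f (τ * s))
    (B' := fun τ : ℝ => s * f' s - f' (τ * s) * s) (a := 0) (b := 1)
    (fun τ hτ => (hφ τ hτ).continuousAt.continuousWithinAt)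
    (fun τ hτ => (hφ τ (Ico_subset_Icc_self hτ)).hasDerivWithinAt)
    (by simp [hFxs, h0])
    (fun τ hτ => (hg τ hτ).continuousWithinAt)
    (fun τ hτ => (hg τ (Ico_subset_Icc_self hτ)).mono_of_mem_nhdsWithin
      (Icc_mem_nhdsGE_of_mem hτ))
    (fun τ hτ => by
      have h := (B.comp (F' x - F' (xs + τ • v))).le_of_opNorm_le
        (hMH τ (Ico_subset_Icc_self hτ)) v
      calc _ ≤ (f' s - f' (τ * s)) * s := h
        _ = _ := by ring)
  simpa [hv] using key (right_mem_Icc.2 zero_le_one)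

theorem stmt7
    {X Y : Type*} [NormedAddCommGroup X] [NormedSpace ℝ X] [CompleteSpace X]
    [NormedAddCommGroup Y] [NormedSpace ℝ Y] [CompleteSpace Y]
    (Ω : Set X) (hΩ : IsOpen Ω)
    (F : X → Y) (F' : X → X →L[ℝ] Y)
    (hF : ∀ x ∈ Ω, HasFDerivAt F (F' x) x)
    (hF'c : ContinuousOn F' Ω)
    (xs : X) (hxs : xs ∈ Ω) (hFxs : F xs = 0)
    (B : Y →L[ℝ] X)
    (hB1 : B.comp (F' xs) = ContinuousLinearMap.id ℝ X)
    (hB2 : (F' xs).comp B = ContinuousLinearMap.id ℝ Y)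
    (R : ℝ) (hR : 0 < R)
    (κ : ℝ) (hκ : κ = sSup {t | t ∈ Ico 0 R ∧ ball xs t ⊆ Ω})
    (f f' : ℝ → ℝ)
    (hfd : ∀ t ∈ Ico 0 R, HasDerivWithinAt f (f' t) (Ico 0 R) t)
    (hf'c : ContinuousOn f' (Ico 0 R))
    (hMH : ∀ τ ∈ Icc (0:ℝ) 1, ∀ x ∈ ball xs κ,
      ‖B.comp (F' x - F' (xs + τ • (x - xs)))‖ ≤ f' ‖x - xs‖ - f' (τ * ‖x - xs‖))
    (h1 : f 0 = 0) (h1' : f' 0 = -1)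
    (h2 : StrictMonoOn f' (Ico 0 R))
    (ν : ℝ) (hν : ν = sSup {t | t ∈ Ico 0 R ∧ f' t < 0})
    (ρ : ℝ) (hρ : ρ = sSup {δ | δ ∈ Ioo 0 ν ∧ ∀ t ∈ Ioo 0 δ, (f t / f' t - t) / t < 1})
    (r : ℝ) (hr : r = min κ ρ)
    : ∀ x : X, ‖x - xs‖ < r →
      ∀ G : Y →L[ℝ] X, G.comp (F' x) = ContinuousLinearMap.id ℝ X →
        (F' x).comp G = ContinuousLinearMap.id ℝ Y →
        ‖(x - G (F x)) - xs‖ ≤ |‖x - xs‖ - f ‖x - xs‖ / f' ‖x - xs‖| ∧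
        x - G (F x) ∈ ball xs r := by
  intro x hx G _ hG
  have hr0 : 0 < r := (norm_nonneg _).trans_lt hx
  rcases eq_or_ne x xs with rfl | hne
  · simp [hFxs, h1, hr0]
  have hs0 : 0 < ‖x - xs‖ := norm_pos_iff.2 (sub_ne_zero.2 hne)
  have hxκ : ‖x - xs‖ < κ := hx.trans_le (hr ▸ min_le_left _ _)
  have hxρ : ‖x - xs‖ < ρ := hx.trans_le (hr ▸ min_le_right _ _)
  have exists_of_lt : ∀ {S : Set ℝ}, ‖x - xs‖ < sSup S → ∃ t ∈ S, ‖x - xs‖ < t := by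
    intro S h
    rcases S.eq_empty_or_nonempty with rfl | hS
    · rw [Real.sSup_empty] at h
      exact absurd h hs0.le.not_gt
    · exact exists_lt_of_lt_csSup hS h
  obtain ⟨a, ⟨-, haΩ⟩, hxa⟩ := exists_of_lt (hκ ▸ hxκ)
  obtain ⟨δ, ⟨hδν, hδ⟩, hxδ⟩ := exists_of_lt (hρ ▸ hxρ)
  obtain ⟨b, ⟨hbR, hb⟩, hxb⟩ := exists_of_lt (hν ▸ hxδ.trans hδν.2)
  have hxR : ‖x - xs‖ < R := hxb.trans hbR.2
  have hneg : f' ‖x - xs‖ < 0 := (h2 ⟨hs0.le, hxR⟩ hbR hxb).trans hb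
  have hxball : x ∈ ball xs κ := mem_ball_iff_norm.2 hxκ
  have herr := norm_newton_error_le B (x := x) (F := F) (F' := F') (xs := xs)
    (fun τ hτ => hF _ (haΩ (by
      rw [mem_ball_iff_norm, add_sub_cancel_left, norm_smul, Real.norm_of_nonneg hτ.1]
      exact (mul_le_of_le_one_left hs0.le hτ.2).trans_lt hxa)))
    hFxs hfd h1 hxR (fun τ hτ => hMH τ hτ x hxball)
  set w := x - G (F x) - xs with hw
  have hFG : F' x (G (F x)) = F x := by
    simpa using DFunLike.congr_fun hG (F x)
  have hFw : F' x w = F' x (x - xs) - F x := by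
    rw [hw, sub_right_comm, map_sub, hFG]
  have hBw : B (F' xs w) = w := by simpa using DFunLike.congr_fun hB1 w
  have hdist : ‖B (F' x w) - w‖ ≤ (f' ‖x - xs‖ + 1) * ‖w‖ := by
    have h := (B.comp (F' x - F' (xs + (0 : ℝ) • (x - xs)))).le_of_opNorm_le
      (hMH 0 (by simp) x hxball) w
    simpa [h1', hBw] using h
  have hlow : ‖w‖ * -f' ‖x - xs‖ ≤ ‖B (F' x w)‖ := by
    have := norm_sub_norm_le w (B (F' x w))
    rw [norm_sub_rev w (B (F' x w))] at this
    linarith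
  rw [hFw] at hlow
  have hbound : ‖w‖ ≤ f ‖x - xs‖ / f' ‖x - xs‖ - ‖x - xs‖ := by
    have h := (le_div_iff₀ (neg_pos.2 hneg)).2 (hlow.trans herr)
    refine h.trans_eq ?_
    field_simp [hneg.ne]
    ring
  have hcontr : f ‖x - xs‖ / f' ‖x - xs‖ - ‖x - xs‖ < ‖x - xs‖ := by
    simpa using (div_lt_iff₀ hs0).1 (hδ _ ⟨hs0, hxδ⟩)
  refine ⟨?_, mem_ball_iff_norm.2 ((hbound.trans_lt hcontr).trans hx)⟩
  rw [abs_sub_comm]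
  exact hbound.trans (le_abs_self _)
end

section
/- If, for a given p with 0 ≤ p ≤ 1, the function t ↦ (f(t)/f'(t) − t)/t^{p+1} is strictly increasing on (0, ν), and if ‖x − x*‖ ≤ t < r, then ‖N_F(x) − x*‖ ≤ [|n_f(t)|/t^{p+1}] · ‖x − x*‖^{p+1}, where N_F(x) := x − F'(x)^{-1}F(x) and n_f(t) := t − f(t)/f'(t). -/
open Filter Metric Set Topology

theorem exists_lt_of_nonneg_of_lt_sSup {S : Set ℝ} {t : ℝ} (ht : 0 ≤ t) (h : t < sSup S) :
    ∃ s ∈ S, t < s := by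
  rcases S.eq_empty_or_nonempty with rfl | hS
  · rw [Real.sSup_empty] at h
    exact absurd h ht.not_gt
  · exact exists_lt_of_lt_csSup hS h

/-- Linearization error bound for a map whose derivative satisfies a majorant condition along the
segment from `xs` to `x`. -/
theorem norm_linearization_error_le_of_majorant
    {X Y : Type*} [NormedAddCommGroup X] [NormedSpace ℝ X]
    [NormedAddCommGroup Y] [NormedSpace ℝ Y]
    {F : X → Y} {F' : X → X →L[ℝ] Y} {xs x : X} {B : Y →L[ℝ] X} {R : ℝ} {f f' : ℝ → ℝ}
    (hF : ∀ τ ∈ Icc (0 : ℝ) 1, HasFDerivAt F (F' (xs + τ • (x - xs))) (xs + τ • (x - xs)))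
    (hFxs : F xs = 0) (hu : 0 < ‖x - xs‖) (huR : ‖x - xs‖ < R)
    (hfd : ∀ t ∈ Ico 0 R, HasDerivWithinAt f (f' t) (Ico 0 R) t) (h1 : f 0 = 0)
    (hMH : ∀ τ ∈ Icc (0 : ℝ) 1,
      ‖B.comp (F' x - F' (xs + τ • (x - xs)))‖ ≤ f' ‖x - xs‖ - f' (τ * ‖x - xs‖)) :
    ‖B (F' x (x - xs) - F x)‖ ≤ ‖x - xs‖ * f' ‖x - xs‖ - f ‖x - xs‖ := by
  set u := ‖x - xs‖ with hu_def
  have hmem : ∀ τ ∈ Icc (0 : ℝ) 1, τ * u ∈ Ico 0 R := fun τ hτ =>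
    ⟨mul_nonneg hτ.1 hu.le, (mul_le_of_le_one_left hu.le hτ.2).trans_lt huR⟩
  have hφ : ∀ τ ∈ Icc (0 : ℝ) 1,
      HasDerivAt (fun τ : ℝ => B (τ • F' x (x - xs) - F (xs + τ • (x - xs))))
        (B (F' x (x - xs) - F' (xs + τ • (x - xs)) (x - xs))) τ := by
    intro τ hτ
    have hl : HasDerivAt (fun τ : ℝ => xs + τ • (x - xs)) (x - xs) τ := by
      simpa using ((hasDerivAt_id τ).smul_const (x - xs)).const_add xs
    have hl' : HasDerivAt (fun τ : ℝ => τ • F' x (x - xs)) (F' x (x - xs)) τ := by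
      simpa using (hasDerivAt_id τ).smul_const (F' x (x - xs))
    exact B.hasFDerivAt.comp_hasDerivAt τ (hl'.sub ((hF τ hτ).comp_hasDerivAt τ hl))
  have hψ : ∀ τ ∈ Icc (0 : ℝ) 1,
      HasDerivWithinAt (fun τ : ℝ => τ * (u * f' u) - f (τ * u))
        (u * f' u - f' (τ * u) * u) (Icc 0 1) τ := by
    intro τ hτ
    have hl : HasDerivWithinAt (fun τ : ℝ => τ * u) u (Icc 0 1) τ := by
      simpa using ((hasDerivAt_id τ).mul_const u).hasDerivWithinAt
    have hl' : HasDerivWithinAt (fun τ : ℝ => τ * (u * f' u)) (u * f' u) (Icc 0 1) τ := by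
      simpa using ((hasDerivAt_id τ).mul_const (u * f' u)).hasDerivWithinAt
    exact hl'.sub ((hfd _ (hmem τ hτ)).comp τ hl hmem)
  have key := image_norm_le_of_norm_deriv_right_le_deriv_boundary'
    (fun τ hτ => (hφ τ hτ).continuousAt.continuousWithinAt)
    (fun τ hτ => (hφ τ (Ico_subset_Icc_self hτ)).hasDerivWithinAt)
    (B := fun τ : ℝ => τ * (u * f' u) - f (τ * u)) (by simp [hFxs, h1])
    (fun τ hτ => (hψ τ hτ).continuousWithinAt)
    (fun τ hτ => (hψ τ (Ico_subset_Icc_self hτ)).mono_of_mem_nhdsWithin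
      (Icc_mem_nhdsGE_of_mem hτ))
    (fun τ hτ => by
      have h := (B.comp (F' x - F' (xs + τ • (x - xs)))).le_of_opNorm_le
        (hMH τ (Ico_subset_Icc_self hτ)) (x - xs)
      simp only [ContinuousLinearMap.comp_apply, sub_apply] at h
      exact h.trans_eq (by rw [← hu_def]; ring))
    (right_mem_Icc.2 zero_le_one)
  simpa using key

theorem stmt8
    {X Y : Type*} [NormedAddCommGroup X] [NormedSpace ℝ X] [CompleteSpace X]
    [NormedAddCommGroup Y] [NormedSpace ℝ Y] [CompleteSpace Y]
    (Ω : Set X) (hΩ : IsOpen Ω)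
    (F : X → Y) (F' : X → X →L[ℝ] Y)
    (hF : ∀ x ∈ Ω, HasFDerivAt F (F' x) x)
    (hF'c : ContinuousOn F' Ω)
    (xs : X) (hxs : xs ∈ Ω) (hFxs : F xs = 0)
    (B : Y →L[ℝ] X)
    (hB1 : B.comp (F' xs) = ContinuousLinearMap.id ℝ X)
    (hB2 : (F' xs).comp B = ContinuousLinearMap.id ℝ Y)
    (R : ℝ) (hR : 0 < R)
    (κ : ℝ) (hκ : κ = sSup {t | t ∈ Ico 0 R ∧ ball xs t ⊆ Ω})
    (f f' : ℝ → ℝ)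
    (hfd : ∀ t ∈ Ico 0 R, HasDerivWithinAt f (f' t) (Ico 0 R) t)
    (hf'c : ContinuousOn f' (Ico 0 R))
    (hMH : ∀ τ ∈ Icc (0:ℝ) 1, ∀ x ∈ ball xs κ,
      ‖B.comp (F' x - F' (xs + τ • (x - xs)))‖ ≤ f' ‖x - xs‖ - f' (τ * ‖x - xs‖))
    (h1 : f 0 = 0) (h1' : f' 0 = -1)
    (h2 : StrictMonoOn f' (Ico 0 R))
    (ν : ℝ) (hν : ν = sSup {t | t ∈ Ico 0 R ∧ f' t < 0})
    (ρ : ℝ) (hρ : ρ = sSup {δ | δ ∈ Ioo 0 ν ∧ ∀ t ∈ Ioo 0 δ, (f t / f' t - t) / t < 1})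
    (r : ℝ) (hr : r = min κ ρ)
    (p : ℝ) (hp0 : 0 ≤ p) (hp1 : p ≤ 1)
    (h3 : StrictMonoOn (fun t : ℝ => (f t / f' t - t) / t ^ (p+1)) (Ioo 0 ν))
    : ∀ (x : X) (t : ℝ), ‖x - xs‖ ≤ t → t < r →
      ∀ G : Y →L[ℝ] X, G.comp (F' x) = ContinuousLinearMap.id ℝ X →
        (F' x).comp G = ContinuousLinearMap.id ℝ Y →
        ‖(x - G (F x)) - xs‖ ≤ (|t - f t / f' t| / t ^ (p+1)) * ‖x - xs‖ ^ (p+1) := by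
  intro x t hxt htr G hG1 hG2
  set u := ‖x - xs‖ with hu_def
  have hu0 : 0 ≤ u := norm_nonneg _
  have ht0 : 0 ≤ t := hu0.trans hxt
  rcases hu0.eq_or_lt with hu | hu
  · have hx : x = xs := sub_eq_zero.1 (norm_eq_zero.1 hu.symm)
    rw [hx, hFxs, map_zero, sub_zero, sub_self, norm_zero]
    positivity
  have htκ : t < κ := htr.trans_le (hr ▸ min_le_left _ _)
  obtain ⟨s, ⟨⟨-, hsR⟩, hsΩ⟩, hts⟩ := exists_lt_of_nonneg_of_lt_sSup ht0 (hκ ▸ htκ)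
  obtain ⟨δ, ⟨⟨-, hδν⟩, -⟩, htδ⟩ := exists_lt_of_nonneg_of_lt_sSup ht0
    (hρ ▸ htr.trans_le (hr ▸ min_le_right _ _))
  have htν : t < ν := htδ.trans hδν
  obtain ⟨w, ⟨hwR, hw⟩, htw⟩ := exists_lt_of_nonneg_of_lt_sSup ht0 (hν ▸ htν)
  have huR : u < R := hxt.trans_lt (hts.trans hsR)
  have hfu : f' u < 0 := (h2 ⟨hu0, huR⟩ hwR (hxt.trans_lt htw)).trans hw
  have hxκ : x ∈ ball xs κ := mem_ball_iff_norm.2 (hxt.trans_lt htκ)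
  have hmaj : ‖B (F' x (x - xs) - F x)‖ ≤ u * f' u - f u := by
    refine norm_linearization_error_le_of_majorant (fun τ hτ => hF _ (hsΩ ?_)) hFxs hu huR hfd h1
      (fun τ hτ => hMH τ hτ x hxκ)
    rw [mem_ball_iff_norm, add_sub_cancel_left, norm_smul, Real.norm_of_nonneg hτ.1]
    exact (mul_le_of_le_one_left hu0 hτ.2).trans_lt (hxt.trans_lt hts)
  set z := (x - G (F x)) - xs with hz
  have hBz : B (F' x z) = B (F' x (x - xs) - F x) := by
    have hFG : F' x (G (F x)) = F x := DFunLike.congr_fun hG2 (F x)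
    rw [hz, sub_right_comm, map_sub, hFG]
  have hBxs : B (F' xs z) = z := DFunLike.congr_fun hB1 z
  have hE : ‖B (F' x z) - z‖ ≤ (f' u + 1) * ‖z‖ := by
    have h := (B.comp (F' x - F' (xs + (0 : ℝ) • (x - xs)))).le_of_opNorm_le
      (hMH 0 (by simp) x hxκ) z
    simpa [hBxs, h1'] using h
  have hzle : ‖z‖ ≤ f u / f' u - u := by
    have h := norm_sub_norm_le z (B (F' x z))
    rw [norm_sub_rev z (B (F' x z)), hBz] at h
    rw [hBz] at hE
    have h4 : ‖z‖ * -f' u ≤ u * f' u - f u := by linarith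
    rw [← le_div_iff₀ (neg_pos.2 hfu)] at h4
    refine h4.trans_eq ?_
    field_simp [hfu.ne]
    ring
  have hmono : (f u / f' u - u) / u ^ (p + 1) ≤ (f t / f' t - t) / t ^ (p + 1) :=
    h3.monotoneOn ⟨hu, hxt.trans_lt htν⟩ ⟨hu.trans_le hxt, htν⟩ hxt
  have hup : 0 < u ^ (p + 1) := Real.rpow_pos_of_pos hu _
  calc ‖z‖ ≤ f u / f' u - u := hzle
    _ = (f u / f' u - u) / u ^ (p + 1) * u ^ (p + 1) := (div_mul_cancel₀ _ hup.ne').symm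
    _ ≤ (f t / f' t - t) / t ^ (p + 1) * u ^ (p + 1) := by gcongr
    _ ≤ |t - f t / f' t| / t ^ (p + 1) * u ^ (p + 1) := by
      gcongr
      rw [abs_sub_comm]
      exact le_abs_self _
end

section
/- The point x* is the unique zero of F in the open ball B(x*, σ); that is, if y ∈ B(x*, σ) and F(y) = 0, then y = x*. -/
open Filter Metric Set Topology

/-- A function on `[0, R)` with monotone derivative, vanishing at `0` and negative at `s`, is
negative on `(0, s]`. -/
theorem neg_of_monotoneOn_deriv {R : ℝ} {f f' : ℝ → ℝ}
    (hfd : ∀ t ∈ Ico 0 R, HasDerivWithinAt f (f' t) (Ico 0 R) t)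
    (hmono : MonotoneOn f' (Ico 0 R)) (h0 : f 0 = 0)
    {r s : ℝ} (hr : 0 < r) (hrs : r ≤ s) (hsR : s < R) (hs : f s < 0) : f r < 0 := by
  have hd : ∀ t ∈ Ioo 0 R, HasDerivAt f (f' t) t := fun t ht =>
    (hfd t ⟨ht.1.le, ht.2⟩).hasDerivAt (Ico_mem_nhds ht.1 ht.2)
  have hconv : ConvexOn ℝ (Ico 0 R) f := by
    refine MonotoneOn.convexOn_of_deriv (convex_Ico 0 R)
      (fun t ht => (hfd t ht).continuousWithinAt) ?_ ?_
    · rw [interior_Ico]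
      exact fun t ht => (hd t ht).differentiableAt.differentiableWithinAt
    · rw [interior_Ico]
      intro a ha b hb hab
      rw [(hd a ha).deriv, (hd b hb).deriv]
      exact hmono ⟨ha.1.le, ha.2⟩ ⟨hb.1.le, hb.2⟩ hab
  have hspos : 0 < s := hr.trans_le hrs
  have key : f ((1 - r / s) • 0 + (r / s) • s) ≤ (1 - r / s) • f 0 + (r / s) • f s :=
    hconv.2 ⟨le_rfl, hspos.trans hsR⟩ ⟨hspos.le, hsR⟩
      (sub_nonneg.2 ((div_le_one hspos).2 hrs)) (by positivity) (by ring)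
  simp only [smul_eq_mul, mul_zero, zero_add, h0, div_mul_cancel₀ r hspos.ne'] at key
  exact key.trans_lt (mul_neg_of_pos_of_neg (by positivity) hs)

/-- If the derivative of a curve `A` with `A 0 = 0` stays within distance `f' s + 1` of a fixed
vector `v`, then `A r` is within distance `f r + r` of `r • v`. -/
theorem norm_sub_smul_le_of_majorant {X : Type*} [NormedAddCommGroup X] [NormedSpace ℝ X]
    {R r : ℝ} (hr : 0 ≤ r) (hrR : r < R) {f f' : ℝ → ℝ}
    (hfd : ∀ t ∈ Ico 0 R, HasDerivWithinAt f (f' t) (Ico 0 R) t) (h0 : f 0 = 0)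
    {A A' : ℝ → X} {v : X} (hA : ∀ s ∈ Icc 0 r, HasDerivAt A (A' s) s) (hA0 : A 0 = 0)
    (hbound : ∀ s ∈ Icc 0 r, ‖A' s - v‖ ≤ f' s + 1) :
    ‖A r - r • v‖ ≤ f r + r := by
  have hd : ∀ s ∈ Icc 0 r, HasDerivAt (fun s => A s - s • v) (A' s - v) s := fun s hs =>
    (hA s hs).fun_sub (by simpa using (hasDerivAt_id s).smul_const v)
  have hsub : Icc 0 r ⊆ Ico 0 R := fun s hs => ⟨hs.1, hs.2.trans_lt hrR⟩
  refine image_norm_le_of_norm_deriv_right_le_deriv_boundary'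
    (f := fun s => A s - s • v) (f' := fun s => A' s - v) (a := 0) (b := r)
    (B := fun s => f s + s) (B' := fun s => f' s + 1)
    (fun s hs => (hd s hs).continuousAt.continuousWithinAt)
    (fun s hs => (hd s ⟨hs.1, hs.2.le⟩).hasDerivWithinAt) (by simp [hA0, h0]) ?_ ?_
    (fun s hs => hbound s ⟨hs.1, hs.2.le⟩) ⟨hr, le_rfl⟩
  · exact ContinuousOn.add
      (fun s hs => ((hfd s (hsub hs)).continuousWithinAt).mono hsub) continuousOn_id
  · intro s hs
    have hs' : s ∈ Ico 0 R := hsub ⟨hs.1, hs.2.le⟩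
    refine HasDerivWithinAt.add ((hfd s hs').mono_of_mem_nhdsWithin ?_) (hasDerivWithinAt_id s _)
    exact mem_of_superset (Ico_mem_nhdsGE hs'.2) (Ico_subset_Ico_left hs'.1)

theorem stmt9
    {X Y : Type*} [NormedAddCommGroup X] [NormedSpace ℝ X] [CompleteSpace X]
    [NormedAddCommGroup Y] [NormedSpace ℝ Y] [CompleteSpace Y]
    (Ω : Set X) (hΩ : IsOpen Ω)
    (F : X → Y) (F' : X → X →L[ℝ] Y)
    (hF : ∀ x ∈ Ω, HasFDerivAt F (F' x) x)
    (hF'c : ContinuousOn F' Ω)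
    (xs : X) (hxs : xs ∈ Ω) (hFxs : F xs = 0)
    (B : Y →L[ℝ] X)
    (hB1 : B.comp (F' xs) = ContinuousLinearMap.id ℝ X)
    (hB2 : (F' xs).comp B = ContinuousLinearMap.id ℝ Y)
    (R : ℝ) (hR : 0 < R)
    (κ : ℝ) (hκ : κ = sSup {t | t ∈ Ico 0 R ∧ ball xs t ⊆ Ω})
    (f f' : ℝ → ℝ)
    (hfd : ∀ t ∈ Ico 0 R, HasDerivWithinAt f (f' t) (Ico 0 R) t)
    (hf'c : ContinuousOn f' (Ico 0 R))
    (hMH : ∀ τ ∈ Icc (0:ℝ) 1, ∀ x ∈ ball xs κ,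
      ‖B.comp (F' x - F' (xs + τ • (x - xs)))‖ ≤ f' ‖x - xs‖ - f' (τ * ‖x - xs‖))
    (h1 : f 0 = 0) (h1' : f' 0 = -1)
    (h2 : StrictMonoOn f' (Ico 0 R))
    (σ : ℝ) (hσ : σ = sSup {t | t ∈ Ioo 0 κ ∧ f t < 0})
    : ∀ y ∈ ball xs σ, F y = 0 → y = xs := by
  intro y hy hFy
  by_contra hne
  set r := ‖y - xs‖ with hr_def
  have hr : 0 < r := norm_pos_iff.2 (sub_ne_zero.2 hne)
  have hrσ : r < σ := by rwa [mem_ball, dist_eq_norm] at hy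
  have hne' : {t | t ∈ Ioo 0 κ ∧ f t < 0}.Nonempty := by
    by_contra h
    rw [not_nonempty_iff_eq_empty] at h
    rw [h, Real.sSup_empty] at hσ
    linarith
  obtain ⟨s, ⟨⟨_, hsκ⟩, hfs⟩, hrs⟩ := exists_lt_of_lt_csSup hne' (hσ ▸ hrσ)
  obtain ⟨t, ⟨⟨_, htR⟩, htΩ⟩, hst⟩ := exists_lt_of_lt_csSup
    (s := {t | t ∈ Ico 0 R ∧ ball xs t ⊆ Ω}) ⟨0, ⟨le_rfl, hR⟩, by simp⟩ (hκ ▸ hsκ)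
  have hfr : f r < 0 :=
    neg_of_monotoneOn_deriv hfd h2.monotoneOn h1 hr hrs.le (hst.trans htR) hfs
  set v : X := r⁻¹ • (y - xs) with hv_def
  have hv : ‖v‖ = 1 := by
    rw [hv_def, norm_smul, norm_inv, Real.norm_of_nonneg hr.le, ← hr_def, inv_mul_cancel₀ hr.ne']
  have hrv : r • v = y - xs := by rw [hv_def, smul_inv_smul₀ hr.ne']
  have hnorm : ∀ a ∈ Icc 0 r, ‖xs + a • v - xs‖ = a := fun a ha => by
    rw [add_sub_cancel_left, norm_smul, hv, mul_one, Real.norm_of_nonneg ha.1]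
  have key : ‖B (F (xs + r • v)) - r • v‖ ≤ f r + r := by
    refine norm_sub_smul_le_of_majorant (A := fun a => B (F (xs + a • v)))
      (A' := fun a => B (F' (xs + a • v) v)) hr.le (hrs.trans (hst.trans htR)) hfd h1
      (fun a ha => ?_) (by simp [hFxs]) (fun a ha => ?_)
    · have hmem : xs + a • v ∈ Ω := htΩ (by
        rw [mem_ball, dist_eq_norm, hnorm a ha]
        exact ha.2.trans_lt (hrs.trans hst))
      have hline : HasDerivAt (fun a : ℝ => xs + a • v) v a := by
        simpa using ((hasDerivAt_id a).smul_const v).const_add xs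
      exact B.hasFDerivAt.comp_hasDerivAt a ((hF _ hmem).comp_hasDerivAt a hline)
    · have hmem : xs + a • v ∈ ball xs κ := by
        rw [mem_ball, dist_eq_norm, hnorm a ha]
        exact ha.2.trans_lt (hrs.trans hsκ)
      have hM := hMH 0 ⟨le_rfl, zero_le_one⟩ _ hmem
      rw [zero_smul, add_zero, zero_mul, h1', hnorm a ha, sub_neg_eq_add] at hM
      have hBv : B (F' xs v) = v := DFunLike.congr_fun hB1 v
      calc ‖B (F' (xs + a • v) v) - v‖
          = ‖B.comp (F' (xs + a • v) - F' xs) v‖ := by simp [hBv]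
        _ ≤ ‖B.comp (F' (xs + a • v) - F' xs)‖ * ‖v‖ := ContinuousLinearMap.le_opNorm _ _
        _ ≤ f' a + 1 := by rwa [hv, mul_one]
  rw [hrv, add_sub_cancel, hFy, map_zero, zero_sub, norm_neg, ← hr_def] at key
  linarith
end

section
/- If, for a given p with 0 ≤ p ≤ 1, the function t ↦ (f(t)/f'(t) − t)/t^{p+1} is strictly increasing on (0, ν), then for any x₀ ∈ B(x*, r) with x₀ ≠ x*, setting t₀ = ‖x₀ − x*‖ and t_{k+1} = |t_k − f(t_k)/f'(t_k)|, the Newton sequence x_{k+1} = x_k − F'(x_k)^{-1} F(x_k) satisfies ‖x_k − x*‖ ≤ t_k and ‖x_{k+1} − x*‖ ≤ [t_{k+1}/t_k^{p+1}] · ‖x_k − x*‖^{p+1} for all k = 0, 1, 2, …. -/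
open Filter Metric Set Topology

/-- A bounded operator between Banach spaces is invertible as soon as its product with an invertible
operator is at distance less than one from the identity. -/
theorem exists_inverse_of_norm_id_sub_comp_lt_one
    {X Y : Type*} [NormedAddCommGroup X] [NormedSpace ℝ X] [CompleteSpace X]
    [NormedAddCommGroup Y] [NormedSpace ℝ Y] {A₀ A : X →L[ℝ] Y} {B : Y →L[ℝ] X}
    (hB : A₀.comp B = ContinuousLinearMap.id ℝ Y)
    (hA : ‖ContinuousLinearMap.id ℝ X - B.comp A‖ < 1) :
    ∃ G : Y →L[ℝ] X, G.comp A = ContinuousLinearMap.id ℝ X ∧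
      A.comp G = ContinuousLinearMap.id ℝ Y := by
  let u : (X →L[ℝ] X)ˣ := Units.oneSub (ContinuousLinearMap.id ℝ X - B.comp A) hA
  have hu : (u : X →L[ℝ] X) = B.comp A := sub_sub_cancel (1 : X →L[ℝ] X) _
  have hinv : ∀ v, (↑u⁻¹ : X →L[ℝ] X) (B (A v)) = v := fun v => by
    simpa [hu] using congrArg (fun T : X →L[ℝ] X => T v) u.inv_mul
  have hval : ∀ v, B (A ((↑u⁻¹ : X →L[ℝ] X) v)) = v := fun v => by
    simpa [hu] using congrArg (fun T : X →L[ℝ] X => T v) u.mul_inv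
  have hAB : ∀ y, A₀ (B y) = y := fun y => by
    simpa using congrArg (fun T : Y →L[ℝ] Y => T y) hB
  refine ⟨(↑u⁻¹ : X →L[ℝ] X).comp B, ContinuousLinearMap.ext fun v => hinv v,
    ContinuousLinearMap.ext fun y => ?_⟩
  have h := congrArg A₀ (hval (B y))
  rwa [hAB, hAB] at h

/-- The linearization error of `F` is bounded by that of the majorant function `f`. -/
theorem norm_linearization_error_le
    {X Y : Type*} [NormedAddCommGroup X] [NormedSpace ℝ X]
    [NormedAddCommGroup Y] [NormedSpace ℝ Y]
    {F : X → Y} {F' : X → X →L[ℝ] Y} {xs x : X} {B : Y →L[ℝ] X} {f f' : ℝ → ℝ} {R : ℝ}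
    (hF : ∀ τ ∈ Icc (0 : ℝ) 1, HasFDerivAt F (F' (xs + τ • (x - xs))) (xs + τ • (x - xs)))
    (hFxs : F xs = 0) (hx : ‖x - xs‖ < R)
    (hfd : ∀ t ∈ Ico 0 R, HasDerivWithinAt f (f' t) (Ico 0 R) t) (h1 : f 0 = 0)
    (hMH : ∀ τ ∈ Icc (0 : ℝ) 1,
      ‖B.comp (F' x - F' (xs + τ • (x - xs)))‖ ≤ f' ‖x - xs‖ - f' (τ * ‖x - xs‖)) :
    ‖B (F' x (x - xs) - F x)‖ ≤ ‖x - xs‖ * f' ‖x - xs‖ - f ‖x - xs‖ := by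
  set s := ‖x - xs‖ with hs
  have hs0 : 0 ≤ s := norm_nonneg _
  have hmem : ∀ τ ∈ Icc (0 : ℝ) 1, τ * s ∈ Ico 0 R := fun τ hτ =>
    ⟨mul_nonneg hτ.1 hs0, (mul_le_of_le_one_left hs0 hτ.2).trans_lt hx⟩
  have hg : ∀ τ ∈ Icc (0 : ℝ) 1,
      HasDerivAt (fun τ : ℝ => B (τ • F' x (x - xs) - F (xs + τ • (x - xs))))
        (B ((F' x - F' (xs + τ • (x - xs))) (x - xs))) τ := by
    intro τ hτ
    have hl : HasDerivAt (fun τ : ℝ => xs + τ • (x - xs)) (x - xs) τ := by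
      simpa using ((hasDerivAt_id τ).smul_const (x - xs)).const_add xs
    have hm : HasDerivAt (fun τ : ℝ => τ • F' x (x - xs)) (F' x (x - xs)) τ := by
      simpa using (hasDerivAt_id τ).smul_const (F' x (x - xs))
    exact B.hasFDerivAt.comp_hasDerivAt τ (hm.sub ((hF τ hτ).comp_hasDerivAt τ hl))
  have hφ : ∀ τ ∈ Icc (0 : ℝ) 1,
      HasDerivWithinAt (fun τ : ℝ => τ * (s * f' s) - f (τ * s)) (s * f' s - f' (τ * s) * s)
        (Icc 0 1) τ := by
    intro τ hτ
    have hl : HasDerivWithinAt (fun τ : ℝ => τ * s) s (Icc 0 1) τ := by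
      simpa using ((hasDerivAt_id τ).mul_const s).hasDerivWithinAt
    have hm : HasDerivWithinAt (fun τ : ℝ => τ * (s * f' s)) (s * f' s) (Icc 0 1) τ := by
      simpa using ((hasDerivAt_id τ).mul_const (s * f' s)).hasDerivWithinAt
    exact hm.sub ((hfd _ (hmem τ hτ)).comp τ hl hmem)
  have key := image_norm_le_of_norm_deriv_right_le_deriv_boundary'
    (fun τ hτ => (hg τ hτ).continuousAt.continuousWithinAt)
    (fun τ hτ => (hg τ (Ico_subset_Icc_self hτ)).hasDerivWithinAt)
    (by simp [hFxs, h1])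
    (fun τ hτ => (hφ τ hτ).continuousWithinAt)
    (fun τ hτ => (hφ τ (Ico_subset_Icc_self hτ)).mono_of_mem_nhdsWithin
      (Icc_mem_nhdsGE_of_mem hτ))
    (fun τ hτ => by
      have h := (B.comp (F' x - F' (xs + τ • (x - xs)))).le_of_opNorm_le
        (hMH τ (Ico_subset_Icc_self hτ)) (x - xs)
      calc _ ≤ _ := h
        _ = _ := by rw [← hs]; ring)
    (right_mem_Icc.2 zero_le_one)
  simpa using key

/-- A Newton step at `x` is well defined, and the resulting error is at most that of the
Newton step for the majorant function. -/
theorem exists_newton_step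
    {X Y : Type*} [NormedAddCommGroup X] [NormedSpace ℝ X] [CompleteSpace X]
    [NormedAddCommGroup Y] [NormedSpace ℝ Y]
    {F : X → Y} {F' : X → X →L[ℝ] Y} {xs x : X} {B : Y →L[ℝ] X} {f f' : ℝ → ℝ} {R : ℝ}
    (hF : ∀ τ ∈ Icc (0 : ℝ) 1, HasFDerivAt F (F' (xs + τ • (x - xs))) (xs + τ • (x - xs)))
    (hFxs : F xs = 0)
    (hB1 : B.comp (F' xs) = ContinuousLinearMap.id ℝ X)
    (hB2 : (F' xs).comp B = ContinuousLinearMap.id ℝ Y)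
    (hx : ‖x - xs‖ < R)
    (hfd : ∀ t ∈ Ico 0 R, HasDerivWithinAt f (f' t) (Ico 0 R) t)
    (h1 : f 0 = 0) (h1' : f' 0 = -1) (hneg : f' ‖x - xs‖ < 0)
    (hMH : ∀ τ ∈ Icc (0 : ℝ) 1,
      ‖B.comp (F' x - F' (xs + τ • (x - xs)))‖ ≤ f' ‖x - xs‖ - f' (τ * ‖x - xs‖)) :
    ∃ G : Y →L[ℝ] X, G.comp (F' x) = ContinuousLinearMap.id ℝ X ∧
      (F' x).comp G = ContinuousLinearMap.id ℝ Y ∧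
      ‖x - G (F x) - xs‖ ≤ f ‖x - xs‖ / f' ‖x - xs‖ - ‖x - xs‖ := by
  have herr := norm_linearization_error_le hF hFxs hx hfd h1 hMH
  have hclose : ‖ContinuousLinearMap.id ℝ X - B.comp (F' x)‖ ≤ f' ‖x - xs‖ + 1 := by
    have h := hMH 0 (left_mem_Icc.2 zero_le_one)
    rw [zero_smul, add_zero, zero_mul, h1', ContinuousLinearMap.comp_sub, hB1, norm_sub_rev] at h
    linarith
  obtain ⟨G, hG1, hG2⟩ := exists_inverse_of_norm_id_sub_comp_lt_one hB2 (by linarith)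
  refine ⟨G, hG1, hG2, ?_⟩
  have hG : F' x (G (F x)) = F x := by
    simpa using congrArg (fun T : Y →L[ℝ] Y => T (F x)) hG2
  set v := x - G (F x) - xs with hv
  have hBv : B (F' x v) = B (F' x (x - xs) - F x) := by
    rw [hv, show x - G (F x) - xs = (x - xs) - G (F x) by abel, map_sub (F' x), hG]
  have hsplit : v = B (F' x v) + (ContinuousLinearMap.id ℝ X - B.comp (F' x)) v := by simp
  have hnorm : ‖v‖ ≤ ‖B (F' x v)‖ + (f' ‖x - xs‖ + 1) * ‖v‖ := by
    calc ‖v‖ = ‖B (F' x v) + (ContinuousLinearMap.id ℝ X - B.comp (F' x)) v‖ := by rw [← hsplit]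
      _ ≤ _ := (norm_add_le _ _).trans
        (by gcongr; exact ContinuousLinearMap.le_of_opNorm_le _ hclose v)
  rw [hBv] at hnorm
  rw [le_sub_iff_add_le, le_div_iff_of_neg hneg]
  linarith

/-- A function with strictly increasing derivative that vanishes at `0` lies strictly below
`t * f' t`. -/
theorem lt_mul_deriv_of_strictMonoOn {f f' : ℝ → ℝ} {R s : ℝ}
    (hfd : ∀ t ∈ Ico 0 R, HasDerivWithinAt f (f' t) (Ico 0 R) t) (h1 : f 0 = 0)
    (h2 : StrictMonoOn f' (Ico 0 R)) (hs0 : 0 < s) (hsR : s < R) : f s < s * f' s := by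
  obtain ⟨c, hc, hfc⟩ := exists_hasDerivAt_eq_slope f f' hs0
    (fun t ht => ((hfd t ⟨ht.1, ht.2.trans_lt hsR⟩).continuousWithinAt).mono
      fun u hu => ⟨hu.1, hu.2.trans_lt hsR⟩)
    (fun t ht => (hfd t ⟨ht.1.le, ht.2.trans hsR⟩).hasDerivAt
      (Ico_mem_nhds ht.1 (ht.2.trans hsR)))
  have hlt := h2 ⟨hc.1.le, hc.2.trans hsR⟩ ⟨hs0.le, hsR⟩ hc.2
  rw [hfc, h1, sub_zero, sub_zero, div_lt_iff₀ hs0] at hlt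
  linarith

theorem stmt11
    {X Y : Type*} [NormedAddCommGroup X] [NormedSpace ℝ X] [CompleteSpace X]
    [NormedAddCommGroup Y] [NormedSpace ℝ Y] [CompleteSpace Y]
    (Ω : Set X) (hΩ : IsOpen Ω)
    (F : X → Y) (F' : X → X →L[ℝ] Y)
    (hF : ∀ x ∈ Ω, HasFDerivAt F (F' x) x)
    (hF'c : ContinuousOn F' Ω)
    (xs : X) (hxs : xs ∈ Ω) (hFxs : F xs = 0)
    (B : Y →L[ℝ] X)
    (hB1 : B.comp (F' xs) = ContinuousLinearMap.id ℝ X)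
    (hB2 : (F' xs).comp B = ContinuousLinearMap.id ℝ Y)
    (R : ℝ) (hR : 0 < R)
    (κ : ℝ) (hκ : κ = sSup {t | t ∈ Ico 0 R ∧ ball xs t ⊆ Ω})
    (f f' : ℝ → ℝ)
    (hfd : ∀ t ∈ Ico 0 R, HasDerivWithinAt f (f' t) (Ico 0 R) t)
    (hf'c : ContinuousOn f' (Ico 0 R))
    (hMH : ∀ τ ∈ Icc (0:ℝ) 1, ∀ x ∈ ball xs κ,
      ‖B.comp (F' x - F' (xs + τ • (x - xs)))‖ ≤ f' ‖x - xs‖ - f' (τ * ‖x - xs‖))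
    (h1 : f 0 = 0) (h1' : f' 0 = -1)
    (h2 : StrictMonoOn f' (Ico 0 R))
    (ν : ℝ) (hν : ν = sSup {t | t ∈ Ico 0 R ∧ f' t < 0})
    (ρ : ℝ) (hρ : ρ = sSup {δ | δ ∈ Ioo 0 ν ∧ ∀ t ∈ Ioo 0 δ, (f t / f' t - t) / t < 1})
    (r : ℝ) (hr : r = min κ ρ)
    (p : ℝ) (hp0 : 0 ≤ p) (hp1 : p ≤ 1)
    (h3 : StrictMonoOn (fun t : ℝ => (f t / f' t - t) / t ^ (p+1)) (Ioo 0 ν))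
    : ∀ x₀ ∈ ball xs r, x₀ ≠ xs →
      ∀ t : ℕ → ℝ, t 0 = ‖x₀ - xs‖ →
      (∀ k, t (k+1) = |t k - f (t k) / f' (t k)|) →
      ∃ x : ℕ → X, x 0 = x₀ ∧
        (∀ k, ∃ G : Y →L[ℝ] X, G.comp (F' (x k)) = ContinuousLinearMap.id ℝ X ∧
          (F' (x k)).comp G = ContinuousLinearMap.id ℝ Y ∧
          x (k+1) = x k - G (F (x k))) ∧
        (∀ k, ‖x k - xs‖ ≤ t k) ∧
        (∀ k, ‖x (k+1) - xs‖ ≤ (t (k+1) / t k ^ (p+1)) * ‖x k - xs‖ ^ (p+1)) := by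
  intro x₀ hx₀ hne t ht0 htk
  have hr0 : 0 < r := pos_of_mem_ball hx₀
  have hball : ∀ s < κ, s < R ∧ closedBall xs s ⊆ Ω := by
    intro s hs
    have hne : {t | t ∈ Ico 0 R ∧ ball xs t ⊆ Ω}.Nonempty := ⟨0, by simp [hR]⟩
    obtain ⟨d, hd, hsd⟩ := exists_lt_of_lt_csSup hne (hκ ▸ hs)
    exact ⟨hsd.trans hd.1.2, (closedBall_subset_ball hsd).trans hd.2⟩
  have hneg : ∀ s, 0 ≤ s → s < ν → f' s < 0 := by
    intro s hs0 hs
    have hne : {t | t ∈ Ico 0 R ∧ f' t < 0}.Nonempty := ⟨0, by simp [hR, h1']⟩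
    obtain ⟨d, hd, hsd⟩ := exists_lt_of_lt_csSup hne (hν ▸ hs)
    exact (h2 ⟨hs0, hsd.trans hd.1.2⟩ hd.1 hsd).trans hd.2
  have hcontr : ∀ s, 0 ≤ s → s < ρ → s < ν ∧ (0 < s → (f s / f' s - s) / s < 1) := by
    intro s hs0 hs
    have hne : {δ | δ ∈ Ioo 0 ν ∧ ∀ t ∈ Ioo 0 δ, (f t / f' t - t) / t < 1}.Nonempty := by
      by_contra h
      rw [not_nonempty_iff_eq_empty] at h
      rw [h, Real.sSup_empty] at hρ
      linarith
    obtain ⟨d, hd, hsd⟩ := exists_lt_of_lt_csSup hne (hρ ▸ hs)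
    exact ⟨hsd.trans hd.1.2, fun h => hd.2 s ⟨h, hsd⟩⟩
  have hrκ : ∀ s < r, s < κ := fun s hs => hs.trans_le (hr ▸ min_le_left _ _)
  have hrρ : ∀ s < r, s < ρ := fun s hs => hs.trans_le (hr ▸ min_le_right _ _)
  have hpos : ∀ s, 0 < s → s < r → 0 < f s / f' s - s := by
    intro s hs0 hs
    have hlt := lt_mul_deriv_of_strictMonoOn hfd h1 h2 hs0 (hball s (hrκ s hs)).1
    rw [sub_pos, lt_div_iff_of_neg (hneg s hs0.le (hcontr s hs0.le (hrρ s hs)).1)]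
    exact hlt
  have habs : ∀ k, 0 < t k → t k < r → t (k + 1) = f (t k) / f' (t k) - t k := by
    intro k hk hkr
    rw [htk, abs_sub_comm, abs_of_pos (hpos _ hk hkr)]
  have htr : ∀ k, 0 < t k ∧ t k < r := by
    intro k
    induction k with
    | zero => exact ⟨by simpa [ht0, sub_eq_zero] using hne, by rwa [ht0, ← mem_ball_iff_norm]⟩
    | succ k ih =>
      have hlt := (hcontr _ ih.1.le (hrρ _ ih.2)).2 ih.1
      rw [div_lt_one ih.1, ← habs k ih.1 ih.2] at hlt
      exact ⟨habs k ih.1 ih.2 ▸ hpos _ ih.1 ih.2, hlt.trans ih.2⟩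
  have hstep : ∀ x, ∃ y, ‖x - xs‖ < r → ∃ G : Y →L[ℝ] X,
      G.comp (F' x) = ContinuousLinearMap.id ℝ X ∧
      (F' x).comp G = ContinuousLinearMap.id ℝ Y ∧ y = x - G (F x) ∧
      ‖y - xs‖ ≤ f ‖x - xs‖ / f' ‖x - xs‖ - ‖x - xs‖ := by
    intro x
    by_cases hx : ‖x - xs‖ < r
    · obtain ⟨hR', hsub⟩ := hball _ (hrκ _ hx)
      obtain ⟨G, hG1, hG2, hG⟩ := exists_newton_step (F := F) (F' := F') (f := f) (f' := f')
        (fun τ hτ => hF _ (hsub (by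
          rw [mem_closedBall_iff_norm, add_sub_cancel_left, norm_smul, Real.norm_of_nonneg hτ.1]
          exact mul_le_of_le_one_left (norm_nonneg _) hτ.2)))
        hFxs hB1 hB2 hR' hfd h1 h1'
        (hneg _ (norm_nonneg _) (hcontr _ (norm_nonneg _) (hrρ _ hx)).1)
        (fun τ hτ => hMH τ hτ x (mem_ball_iff_norm.2 (hrκ _ hx)))
      exact ⟨_, fun _ => ⟨G, hG1, hG2, rfl, hG⟩⟩
    · exact ⟨x, fun h => absurd h hx⟩
  choose N hN using hstep
  have hrate : ∀ k x, ‖x - xs‖ ≤ t k →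
      ‖N x - xs‖ ≤ (t (k + 1) / t k ^ (p + 1)) * ‖x - xs‖ ^ (p + 1) := by
    intro k x hx
    obtain ⟨hk0, hkr⟩ := htr k
    obtain ⟨-, -, -, -, hle⟩ := hN x (hx.trans_lt hkr)
    rcases (norm_nonneg (x - xs)).eq_or_lt with h0 | h0
    · rw [← h0, h1, zero_div, sub_zero] at hle
      rwa [← h0, Real.zero_rpow (by linarith), mul_zero]
    · have hmono := h3.monotoneOn
        ⟨h0, hx.trans_lt (hcontr _ hk0.le (hrρ _ hkr)).1⟩
        ⟨hk0, (hcontr _ hk0.le (hrρ _ hkr)).1⟩ hx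
      rw [← habs k hk0 hkr, div_le_iff₀ (Real.rpow_pos_of_pos h0 _)] at hmono
      exact hle.trans hmono
  have hle : ∀ k, ‖N^[k] x₀ - xs‖ ≤ t k := by
    intro k
    induction k with
    | zero => exact ht0.ge
    | succ k ih =>
      obtain ⟨hk0, -⟩ := htr k
      have hk1 := (htr (k + 1)).1
      have hp : 0 < t k ^ (p + 1) := Real.rpow_pos_of_pos hk0 _
      rw [Function.iterate_succ_apply']
      calc _ ≤ _ := hrate k _ ih
        _ ≤ t (k + 1) / t k ^ (p + 1) * t k ^ (p + 1) := by gcongr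
        _ = t (k + 1) := div_mul_cancel₀ _ hp.ne'
  refine ⟨fun k => N^[k] x₀, rfl, fun k => ?_, hle, fun k => ?_⟩
  · obtain ⟨G, hG1, hG2, hy, -⟩ := hN _ ((hle k).trans_lt (htr k).2)
    exact ⟨G, hG1, hG2, (Function.iterate_succ_apply' N k x₀).trans hy⟩
  · simp only [Function.iterate_succ_apply']
    exact hrate k _ (hle k)
end

section
/- Under the Hölder-like condition, x* is the unique zero of F in the open ball B(x*, min{κ, ((p+1)/K)^{1/p}}); that is, if y lies in that ball and F(y) = 0, then y = x*. -/
open Filter Metric Set Topology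

theorem stmt14
    {X Y : Type*} [NormedAddCommGroup X] [NormedSpace ℝ X] [CompleteSpace X]
    [NormedAddCommGroup Y] [NormedSpace ℝ Y] [CompleteSpace Y]
    (Ω : Set X) (hΩ : IsOpen Ω)
    (F : X → Y) (F' : X → X →L[ℝ] Y)
    (hF : ∀ x ∈ Ω, HasFDerivAt F (F' x) x)
    (hF'c : ContinuousOn F' Ω)
    (xs : X) (hxs : xs ∈ Ω) (hFxs : F xs = 0)
    (B : Y →L[ℝ] X)
    (hB1 : B.comp (F' xs) = ContinuousLinearMap.id ℝ X)
    (hB2 : (F' xs).comp B = ContinuousLinearMap.id ℝ Y)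
    (R : ℝ) (hR : 0 < R)
    (κ : ℝ) (hκ : κ = sSup {t | t ∈ Ico 0 R ∧ ball xs t ⊆ Ω})
    (K p : ℝ) (hK : 0 < K) (hp0 : 0 < p) (hp1 : p ≤ 1)
    (hHol : ∀ x ∈ ball xs κ, ∀ τ ∈ Icc (0:ℝ) 1,
      ‖B.comp (F' x - F' (xs + τ • (x - xs)))‖ ≤ K * (1 - τ ^ p) * ‖x - xs‖ ^ p)
    : ∀ y ∈ ball xs (min κ (((p+1) / K) ^ (1/p))), F y = 0 → y = xs := by
  intro y hy hFy
  by_contra hne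
  rw [mem_ball, lt_min_iff, dist_eq_norm] at hy
  obtain ⟨hyκ, hyp⟩ := hy
  set v := y - xs
  have hr : 0 < ‖v‖ := norm_pos_iff.mpr (sub_ne_zero.mpr hne)
  have hsmall : K * ‖v‖ ^ p < p + 1 := by
    have h := Real.rpow_lt_rpow hr.le hyp hp0
    rw [← Real.rpow_mul (by positivity), one_div_mul_cancel hp0.ne', Real.rpow_one,
      lt_div_iff₀ hK] at h
    linarith
  obtain ⟨t, ⟨-, htΩ⟩, hvt⟩ := exists_lt_of_lt_csSup
    (s := {t | t ∈ Ico 0 R ∧ ball xs t ⊆ Ω}) ⟨0, ⟨le_rfl, hR⟩, by simp⟩ (hκ ▸ hyκ)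
  have hnorm : ∀ s ∈ Icc (0 : ℝ) 1, ‖s • v‖ ≤ ‖v‖ := fun s hs => by
    rw [norm_smul, Real.norm_of_nonneg hs.1]
    exact mul_le_of_le_one_left hr.le hs.2
  have hg : ∀ s ∈ Icc (0 : ℝ) 1,
      HasDerivAt (fun s : ℝ => B (F (xs + s • v)) - s • v) (B (F' (xs + s • v) v) - v) s := by
    intro s hs
    have hmem : xs + s • v ∈ Ω := htΩ (by
      rw [mem_ball, dist_eq_norm, add_sub_cancel_left]
      exact (hnorm s hs).trans_lt hvt)
    have hline : HasDerivAt (fun s : ℝ => s • v) v s := by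
      simpa using (hasDerivAt_id s).smul_const v
    exact (B.hasFDerivAt.comp_hasDerivAt s
      ((hF _ hmem).comp_hasDerivAt s (hline.const_add xs))).sub hline
  have hbound : ∀ s ∈ Ico (0 : ℝ) 1,
      ‖B (F' (xs + s • v) v) - v‖ ≤ K * ‖v‖ ^ p * ‖v‖ * s ^ p := by
    intro s hs
    have hs' := Ico_subset_Icc_self hs
    have h := hHol (xs + s • v) (by
      rw [mem_ball, dist_eq_norm, add_sub_cancel_left]
      exact (hnorm s hs').trans_lt hyκ) 0 (by simp)
    rw [zero_smul, add_zero, Real.zero_rpow hp0.ne', sub_zero, mul_one, add_sub_cancel_left,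
      norm_smul, Real.norm_of_nonneg hs.1, Real.mul_rpow hs.1 hr.le] at h
    have hBv : B (F' xs v) = v := by simpa using congrArg (fun A => A v) hB1
    calc ‖B (F' (xs + s • v) v) - v‖
        = ‖B.comp (F' (xs + s • v) - F' xs) v‖ := by simp [hBv]
      _ ≤ K * (s ^ p * ‖v‖ ^ p) * ‖v‖ := ContinuousLinearMap.le_of_opNorm_le _ h v
      _ = K * ‖v‖ ^ p * ‖v‖ * s ^ p := by ring
  have hmajor : ∀ s : ℝ, HasDerivAt (fun s : ℝ => K * ‖v‖ ^ p * ‖v‖ / (p + 1) * s ^ (p + 1))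
      (K * ‖v‖ ^ p * ‖v‖ * s ^ p) s := by
    intro s
    refine ((Real.hasDerivAt_rpow_const (x := s) (p := p + 1)
      (Or.inr (by linarith))).const_mul (K * ‖v‖ ^ p * ‖v‖ / (p + 1))).congr_deriv ?_
    rw [add_sub_cancel_right]
    field_simp
  have key := image_norm_le_of_norm_deriv_right_le_deriv_boundary
    (fun s hs => (hg s hs).continuousAt.continuousWithinAt)
    (fun s hs => (hg s (Ico_subset_Icc_self hs)).hasDerivWithinAt)
    (by simp [hFxs, Real.zero_rpow (by linarith : p + 1 ≠ 0)]) hmajor hbound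
    (right_mem_Icc.mpr zero_le_one)
  have hend : xs + v = y := add_sub_cancel xs y
  simp only [one_smul, hend, hFy, map_zero, zero_sub, norm_neg, Real.one_rpow, mul_one] at key
  rw [le_div_iff₀ (by linarith)] at key
  nlinarith
end

section
/- Under the Hölder-like condition, for any x₀ ∈ B(x*, r) with x₀ ≠ x*, the Newton sequence x_{k+1} = x_k − F'(x_k)^{-1} F(x_k) satisfies ‖x_k − x*‖ ≤ [K p ‖x₀ − x*‖^p / ((p+1)(1 − K ‖x₀ − x*‖^p))]^{[(p+1)^k − 1]/p} · ‖x₀ − x*‖ for all k = 0, 1, 2, …. -/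
open Filter Metric Set Topology

theorem ball_sSup_subset {X : Type*} [PseudoMetricSpace X] (c : X) (Ω : Set X) {R : ℝ}
    (hR : 0 < R) : ball c (sSup {t | t ∈ Ico 0 R ∧ ball c t ⊆ Ω}) ⊆ Ω := by
  intro y hy
  obtain ⟨t, ht, hyt⟩ := exists_lt_of_lt_csSup
    (show {t | t ∈ Ico 0 R ∧ ball c t ⊆ Ω}.Nonempty from ⟨0, ⟨le_rfl, hR⟩, by simp⟩)
    (mem_ball.1 hy)
  exact ht.2 hyt

/-- The linearization error of `f` at `x` with base point `c`, under a radial Hölder condition on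
the derivative along the segment from `c` to `x`. -/
theorem norm_linearization_sub_le {X Z : Type*} [NormedAddCommGroup X] [NormedSpace ℝ X]
    [NormedAddCommGroup Z] [NormedSpace ℝ Z] {f : X → Z} {f' : X → X →L[ℝ] Z} {c x : X}
    {A p : ℝ} (hp : 0 < p)
    (hf : ∀ τ ∈ Icc (0 : ℝ) 1,
      HasFDerivAt f (f' (c + τ • (x - c))) (c + τ • (x - c)))
    (hA : ∀ τ ∈ Icc (0 : ℝ) 1, ‖f' x - f' (c + τ • (x - c))‖ ≤ A * (1 - τ ^ p)) :
    ‖f' x (x - c) - (f x - f c)‖ ≤ A * (p / (p + 1)) * ‖x - c‖ := by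
  have hder : ∀ τ ∈ Icc (0 : ℝ) 1, HasDerivAt
      (fun τ : ℝ => τ • f' x (x - c) - (f (c + τ • (x - c)) - f c))
      (f' x (x - c) - f' (c + τ • (x - c)) (x - c)) τ := by
    intro τ hτ
    have hline : HasDerivAt (fun τ : ℝ => c + τ • (x - c)) (x - c) τ := by
      simpa using ((hasDerivAt_id τ).smul_const (x - c)).const_add c
    have hlin : HasDerivAt (fun τ : ℝ => τ • f' x (x - c)) (f' x (x - c)) τ := by
      simpa using (hasDerivAt_id τ).smul_const (f' x (x - c))
    exact hlin.sub (((hf τ hτ).comp_hasDerivAt τ hline).sub_const _)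
  have hbound : ∀ τ : ℝ, HasDerivAt
      (fun τ : ℝ => A * ‖x - c‖ * (τ - τ ^ (p + 1) / (p + 1)))
      (A * ‖x - c‖ * (1 - τ ^ p)) τ := by
    intro τ
    have hpow := (Real.hasDerivAt_rpow_const (x := τ) (p := p + 1) (Or.inr (by linarith)))
    have h := ((hasDerivAt_id τ).sub (hpow.div_const (p + 1))).const_mul (A * ‖x - c‖)
    have hp' : p + 1 ≠ 0 := by positivity
    rwa [add_sub_cancel_right, mul_div_cancel_left₀ _ hp'] at h
  have h := image_norm_le_of_norm_deriv_right_le_deriv_boundary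
    (fun τ hτ => (hder τ hτ).continuousAt.continuousWithinAt)
    (fun τ hτ => (hder τ (Ico_subset_Icc_self hτ)).hasDerivWithinAt)
    (by simp [Real.zero_rpow (by positivity : p + 1 ≠ 0)]) hbound
    (fun τ hτ => by
      have h1 := hA τ (Ico_subset_Icc_self hτ)
      rw [← sub_apply]
      calc _ ≤ _ := ContinuousLinearMap.le_opNorm _ _
        _ ≤ A * (1 - τ ^ p) * ‖x - c‖ := by gcongr
        _ = _ := by ring)
    (right_mem_Icc.2 zero_le_one)
  have hp' : p + 1 ≠ 0 := by positivity
  simp only [one_smul, Real.one_rpow, add_sub_cancel] at h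
  refine h.trans_eq ?_
  field_simp
  ring

/-- If `B` is a two-sided inverse of `T₀` and `B ∘ T` is within distance less than one of the
identity, then `T` has a two-sided inverse. -/
theorem exists_inverse_of_norm_comp_sub_lt_one {X Y : Type*} [NormedAddCommGroup X]
    [NormedSpace ℝ X] [CompleteSpace X] [NormedAddCommGroup Y] [NormedSpace ℝ Y]
    {T₀ T : X →L[ℝ] Y} {B : Y →L[ℝ] X}
    (hB1 : B.comp T₀ = ContinuousLinearMap.id ℝ X)
    (hB2 : T₀.comp B = ContinuousLinearMap.id ℝ Y)
    (h : ‖B.comp (T - T₀)‖ < 1) :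
    ∃ G : Y →L[ℝ] X, G.comp T = ContinuousLinearMap.id ℝ X ∧
      T.comp G = ContinuousLinearMap.id ℝ Y := by
  obtain ⟨u, hu⟩ : IsUnit (B.comp T) := by
    have hunit := isUnit_one_sub_of_norm_lt_one (x := -(B.comp (T - T₀))) (by rwa [norm_neg])
    convert hunit using 1
    rw [ContinuousLinearMap.comp_sub, hB1, ContinuousLinearMap.one_def]
    abel
  have hT : T = T₀.comp (u : X →L[ℝ] X) := by
    rw [hu, ← ContinuousLinearMap.comp_assoc, hB2, ContinuousLinearMap.id_comp]
  have hinv : ((u⁻¹ : (X →L[ℝ] X)ˣ) : X →L[ℝ] X).comp (u : X →L[ℝ] X)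
      = ContinuousLinearMap.id ℝ X := u.inv_mul
  have hinv' : (u : X →L[ℝ] X).comp ((u⁻¹ : (X →L[ℝ] X)ˣ) : X →L[ℝ] X)
      = ContinuousLinearMap.id ℝ X := u.mul_inv
  refine ⟨((u⁻¹ : (X →L[ℝ] X)ˣ) : X →L[ℝ] X).comp B, ?_, ?_⟩
  · rw [ContinuousLinearMap.comp_assoc, ← hu, hinv]
  · rw [hT, ContinuousLinearMap.comp_assoc, ← ContinuousLinearMap.comp_assoc _ _ B, hinv',
      ContinuousLinearMap.id_comp, hB2]

/-- One step of error propagation for an iteration of order `p + 1`, with `E = (p + 1) ^ k`. -/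
theorem rpow_order_step {q e₀ e e' p E : ℝ} (hp : 0 < p) (hq : 0 < q) (he₀ : 0 < e₀)
    (he : 0 ≤ e) (hle : e ≤ q ^ ((E - 1) / p) * e₀) (he' : e' ≤ q * (e / e₀) ^ p * e) :
    e' ≤ q ^ ((E * (p + 1) - 1) / p) * e₀ := by
  have hdiv : e / e₀ ≤ q ^ ((E - 1) / p) := (div_le_iff₀ he₀).2 hle
  calc e' ≤ q * (e / e₀) ^ p * e := he'
    _ ≤ q * (q ^ ((E - 1) / p)) ^ p * (q ^ ((E - 1) / p) * e₀) := by gcongr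
    _ = q ^ (1 + (E - 1) / p * p + (E - 1) / p) * e₀ := by
      rw [Real.rpow_add hq, Real.rpow_add hq, Real.rpow_one, Real.rpow_mul hq.le]
      ring
    _ = q ^ ((E * (p + 1) - 1) / p) * e₀ := by
      congr 2
      field_simp
      ring

theorem stmt16
    {X Y : Type*} [NormedAddCommGroup X] [NormedSpace ℝ X] [CompleteSpace X]
    [NormedAddCommGroup Y] [NormedSpace ℝ Y] [CompleteSpace Y]
    (Ω : Set X) (hΩ : IsOpen Ω)
    (F : X → Y) (F' : X → X →L[ℝ] Y)
    (hF : ∀ x ∈ Ω, HasFDerivAt F (F' x) x)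
    (hF'c : ContinuousOn F' Ω)
    (xs : X) (hxs : xs ∈ Ω) (hFxs : F xs = 0)
    (B : Y →L[ℝ] X)
    (hB1 : B.comp (F' xs) = ContinuousLinearMap.id ℝ X)
    (hB2 : (F' xs).comp B = ContinuousLinearMap.id ℝ Y)
    (R : ℝ) (hR : 0 < R)
    (κ : ℝ) (hκ : κ = sSup {t | t ∈ Ico 0 R ∧ ball xs t ⊆ Ω})
    (K p : ℝ) (hK : 0 < K) (hp0 : 0 < p) (hp1 : p ≤ 1)
    (hHol : ∀ x ∈ ball xs κ, ∀ τ ∈ Icc (0:ℝ) 1,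
      ‖B.comp (F' x - F' (xs + τ • (x - xs)))‖ ≤ K * (1 - τ ^ p) * ‖x - xs‖ ^ p)
    (r : ℝ) (hr : r = min κ (((p+1) / ((2*p+1) * K)) ^ (1/p)))
    : ∀ x₀ ∈ ball xs r, x₀ ≠ xs →
      ∃ x : ℕ → X, x 0 = x₀ ∧
        (∀ k, ∃ G : Y →L[ℝ] X, G.comp (F' (x k)) = ContinuousLinearMap.id ℝ X ∧
          (F' (x k)).comp G = ContinuousLinearMap.id ℝ Y ∧
          x (k+1) = x k - G (F (x k))) ∧
        (∀ k : ℕ, ‖x k - xs‖ ≤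
          (K * p * ‖x₀ - xs‖ ^ p / ((p+1) * (1 - K * ‖x₀ - xs‖ ^ p))) ^ (((p+1)^k - 1) / p)
            * ‖x₀ - xs‖) := by
  intro x₀ hx₀ hne
  have hsub : ball xs κ ⊆ Ω := hκ ▸ ball_sSup_subset xs Ω hR
  set e₀ := ‖x₀ - xs‖ with he₀
  have he₀pos : 0 < e₀ := norm_pos_iff.2 (sub_ne_zero.2 hne)
  have he₀r : e₀ < r := by rwa [he₀, ← mem_ball_iff_norm]
  have he₀κ : e₀ < κ := he₀r.trans_le (hr ▸ min_le_left _ _)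
  have hbase : 0 < (p + 1) / ((2 * p + 1) * K) := by positivity
  have hpow : K * e₀ ^ p * (2 * p + 1) < p + 1 := by
    have h1 : e₀ < ((p + 1) / ((2 * p + 1) * K)) ^ (1 / p) :=
      he₀r.trans_le (hr ▸ min_le_right _ _)
    have h2 := Real.rpow_lt_rpow he₀pos.le h1 hp0
    rw [← Real.rpow_mul hbase.le, one_div_mul_cancel hp0.ne', Real.rpow_one,
      lt_div_iff₀ (by positivity)] at h2
    linarith
  have hs : 0 < K * e₀ ^ p := by positivity
  have hs1 : K * e₀ ^ p < 1 := by nlinarith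
  have hden : 0 < (p + 1) * (1 - K * e₀ ^ p) := mul_pos (by linarith) (by linarith)
  set q := K * p * e₀ ^ p / ((p + 1) * (1 - K * e₀ ^ p)) with hq
  have hq0 : 0 < q := by positivity
  have hq1 : q ≤ 1 := (div_le_one hden).2 (by nlinarith)
  have hstep : ∀ x, ∃ y, ‖x - xs‖ ≤ e₀ → (∃ G : Y →L[ℝ] X,
      G.comp (F' x) = ContinuousLinearMap.id ℝ X ∧
      (F' x).comp G = ContinuousLinearMap.id ℝ Y ∧ y = x - G (F x)) ∧
      ‖y - xs‖ ≤ q * (‖x - xs‖ / e₀) ^ p * ‖x - xs‖ := by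
    intro x
    by_cases hx : ‖x - xs‖ ≤ e₀
    swap
    · exact ⟨x, fun h => absurd h hx⟩
    have hxκ : x ∈ ball xs κ := mem_ball_iff_norm.2 (hx.trans_lt he₀κ)
    have hxp : K * ‖x - xs‖ ^ p ≤ K * e₀ ^ p := by gcongr
    have hclose : ‖B.comp (F' x - F' xs)‖ ≤ K * e₀ ^ p := by
      have h := hHol x hxκ 0 ⟨le_rfl, zero_le_one⟩
      simp only [zero_smul, add_zero, Real.zero_rpow hp0.ne', sub_zero, mul_one] at h
      exact h.trans hxp
    obtain ⟨G, hG1, hG2⟩ := exists_inverse_of_norm_comp_sub_lt_one hB1 hB2 (hclose.trans_lt hs1)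
    refine ⟨x - G (F x), fun _ => ⟨⟨G, hG1, hG2, rfl⟩, ?_⟩⟩
    have hseg : ∀ τ ∈ Icc (0 : ℝ) 1, xs + τ • (x - xs) ∈ Ω := by
      intro τ hτ
      apply hsub
      rw [mem_ball_iff_norm, add_sub_cancel_left, norm_smul, Real.norm_of_nonneg hτ.1]
      exact (mul_le_of_le_one_left (norm_nonneg _) hτ.2).trans_lt (hx.trans_lt he₀κ)
    have hlin := norm_linearization_sub_le (f := fun z => B (F z))
      (f' := fun z => B.comp (F' z)) (c := xs) (x := x) (A := K * ‖x - xs‖ ^ p) hp0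
      (fun τ hτ => B.hasFDerivAt.comp _ (hF _ (hseg τ hτ)))
      (fun τ hτ => by
        rw [← ContinuousLinearMap.comp_sub]
        exact (hHol x hxκ τ hτ).trans_eq (by ring))
    simp only [hFxs, map_zero, sub_zero, ContinuousLinearMap.comp_apply] at hlin
    set z := x - G (F x) - xs with hz
    have hBz : B (F' x z) = B (F' x (x - xs)) - B (F x) := by
      have hGF : F' x (G (F x)) = F x := congrArg (fun T : Y →L[ℝ] Y => T (F x)) hG2
      rw [hz, sub_right_comm, map_sub, hGF, map_sub]
    rw [← hBz] at hlin
    have hBxs : B (F' xs z) = z := congrArg (fun T : X →L[ℝ] X => T z) hB1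
    have hzeq : z = B (F' x z) - B.comp (F' x - F' xs) z := by
      simp [hBxs]
    have hznorm : ‖z‖ ≤ K * ‖x - xs‖ ^ p * (p / (p + 1)) * ‖x - xs‖ + K * e₀ ^ p * ‖z‖ := by
      calc ‖z‖ = ‖B (F' x z) - B.comp (F' x - F' xs) z‖ := congrArg norm hzeq
        _ ≤ ‖B (F' x z)‖ + ‖B.comp (F' x - F' xs) z‖ := norm_sub_le _ _
        _ ≤ _ := add_le_add hlin (ContinuousLinearMap.le_of_opNorm_le _ hclose z)
    have hrhs : q * (‖x - xs‖ / e₀) ^ p * ‖x - xs‖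
        = K * ‖x - xs‖ ^ p * (p / (p + 1)) * ‖x - xs‖ / (1 - K * e₀ ^ p) := by
      have : 1 - K * e₀ ^ p ≠ 0 := by linarith
      rw [hq, Real.div_rpow (norm_nonneg _) he₀pos.le]
      field_simp
    rw [hrhs, le_div_iff₀ (by linarith)]
    linarith
  choose N hN using hstep
  have hle : ∀ k : ℕ, q ^ (((p + 1) ^ k - 1) / p) * e₀ ≤ e₀ := fun k =>
    mul_le_of_le_one_left he₀pos.le (Real.rpow_le_one hq0.le hq1
      (div_nonneg (sub_nonneg.2 (one_le_pow₀ (by linarith))) hp0.le))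
  have hbound : ∀ k : ℕ, ‖N^[k] x₀ - xs‖ ≤ q ^ (((p + 1) ^ k - 1) / p) * e₀ := by
    intro k
    induction k with
    | zero => simp [he₀]
    | succ k ih =>
      rw [Function.iterate_succ_apply', pow_succ]
      exact rpow_order_step hp0 hq0 he₀pos (norm_nonneg _) ih (hN _ (ih.trans (hle k))).2
  refine ⟨fun k => N^[k] x₀, rfl, fun k => ?_, hbound⟩
  simp only [Function.iterate_succ_apply']
  exact (hN _ ((hbound k).trans (hle k))).1
end
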